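/- arXiv:1706.01418 — 9 statements merged into one kernel-verified Lean document; each statement's English description precedes it below -/
import Mathlib

section
/- A process 𝕏 satisfies Condition 1 if and only if there exists a sequence {F_i}_{i=1}^∞ of nonempty finite sets of measurable functions X → Y such that for every measurable f : X → Y, lim_{i→∞} min_{f_i ∈ F_i} E[μ̂_𝕏(x ↦ ℓ(f_i(x), f(x)))] = 0. -/
open MeasureTheory Filter Topology

/-- The limsup of empirical averages of `g : X → ℝ` along the sequence `x`:
`μ̂_x(g) = limsup_{n→∞} (1/n) ∑_{t=1}^n g(x_t)`. -/
noncomputable def muHat {X : Type*} (x : ℕ → X) (g : X → ℝ) : ℝ :=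
  Filter.limsup (fun n : ℕ => (∑ t ∈ Finset.range n, g (x t)) / (n : ℝ)) Filter.atTop

/-- The limsup empirical frequency of the set `A` along the sequence `x`:
`μ̂_x(A) = μ̂_x(1_A)`. -/
noncomputable def muHatSet {X : Type*} (x : ℕ → X) (A : Set X) : ℝ :=
  muHat x (A.indicator fun _ => (1 : ℝ))

/-- Condition 1: for every monotone sequence `{A_k}` of measurable sets with `A_k ↓ ∅`,
`lim_{k→∞} E[μ̂_𝕏(A_k)] = 0`.  Here the process `𝕏` is represented by its law `μ` on the
path space `ℕ → X`, the coordinates being the random variables `X_t`. -/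
def Condition1 {X : Type*} [MeasurableSpace X] (μ : Measure (ℕ → X)) : Prop :=
  ∀ A : ℕ → Set X, (∀ k, MeasurableSet (A k)) → Antitone A → (⋂ k, A k) = ∅ →
    Tendsto (fun k => ∫ x, muHatSet x (A k) ∂μ) atTop (𝓝 0)

section Helpers

set_option linter.unusedSectionVars false

variable {X : Type*}

noncomputable def avgA (x : ℕ → X) (g : X → ℝ) (n : ℕ) : ℝ :=
  (∑ t ∈ Finset.range n, g (x t)) / (n : ℝ)

lemma muHat_eq (x : ℕ → X) (g : X → ℝ) : muHat x g = limsup (avgA x g) atTop := rfl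

lemma avgA_mono (x : ℕ → X) {g h : X → ℝ} (hgh : ∀ z, g z ≤ h z) (n : ℕ) :
    avgA x g n ≤ avgA x h n :=
  div_le_div_of_nonneg_right (Finset.sum_le_sum fun t _ => hgh (x t)) (Nat.cast_nonneg n)

lemma avgA_nonneg (x : ℕ → X) {g : X → ℝ} (hg : ∀ z, 0 ≤ g z) (n : ℕ) : 0 ≤ avgA x g n :=
  div_nonneg (Finset.sum_nonneg fun t _ => hg (x t)) (Nat.cast_nonneg n)

lemma avgA_le (x : ℕ → X) {g : X → ℝ} {C : ℝ} (hC : 0 ≤ C) (hg : ∀ z, g z ≤ C) (n : ℕ) :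
    avgA x g n ≤ C := by
  unfold avgA
  rcases Nat.eq_zero_or_pos n with rfl | hn
  · simpa using hC
  · rw [div_le_iff₀ (by exact_mod_cast hn)]
    calc _ ≤ ∑ t ∈ Finset.range n, C := Finset.sum_le_sum fun t _ => hg (x t)
      _ = _ := by simp [mul_comm]

/-- nonnegative bounded -/
def NB (g : X → ℝ) : Prop := (∀ z, 0 ≤ g z) ∧ ∃ C, ∀ z, g z ≤ C

lemma NB.exC {g : X → ℝ} (h : NB g) : ∃ C, 0 ≤ C ∧ ∀ z, g z ≤ C := by
  obtain ⟨_, C, hC⟩ := h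
  exact ⟨max C 0, le_max_right _ _, fun z => (hC z).trans (le_max_left _ _)⟩

lemma NB.bdd {g : X → ℝ} (h : NB g) (x : ℕ → X) :
    IsBoundedUnder (· ≤ ·) atTop (avgA x g) := by
  obtain ⟨C, h0, hC⟩ := h.exC
  exact isBoundedUnder_of ⟨C, avgA_le x h0 hC⟩

lemma NB.bdd' {g : X → ℝ} (h : NB g) (x : ℕ → X) :
    IsBoundedUnder (· ≥ ·) atTop (avgA x g) :=
  isBoundedUnder_of ⟨0, avgA_nonneg x h.1⟩

lemma NB.cobdd {g : X → ℝ} (h : NB g) (x : ℕ → X) :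
    IsCoboundedUnder (· ≤ ·) atTop (avgA x g) :=
  (h.bdd' x).isCoboundedUnder_flip

lemma NB.add {g h : X → ℝ} (hg : NB g) (hh : NB h) : NB (fun z => g z + h z) := by
  obtain ⟨C, hC⟩ := hg.2
  obtain ⟨D, hD⟩ := hh.2
  exact ⟨fun z => add_nonneg (hg.1 z) (hh.1 z), C + D, fun z => add_le_add (hC z) (hD z)⟩

lemma NB.cmul {g : X → ℝ} {c : ℝ} (hc : 0 ≤ c) (hg : NB g) : NB (fun z => c * g z) := by
  obtain ⟨C, hC⟩ := hg.2
  exact ⟨fun z => mul_nonneg hc (hg.1 z), c * C, fun z => mul_le_mul_of_nonneg_left (hC z) hc⟩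

lemma NB.ind (A : Set X) : NB (A.indicator fun _ => (1 : ℝ)) :=
  ⟨fun z => Set.indicator_nonneg (fun _ _ => zero_le_one) z, 1, fun z =>
    Set.indicator_le_self' (fun _ _ => zero_le_one) z⟩

lemma muHat_mono {g h : X → ℝ} (hg : NB g) (hh : NB h) (hgh : ∀ z, g z ≤ h z) (x : ℕ → X) :
    muHat x g ≤ muHat x h :=
  limsup_le_limsup (Eventually.of_forall (avgA_mono x hgh)) (hg.cobdd x) (hh.bdd x)

lemma muHat_nonneg {g : X → ℝ} (hg : NB g) (x : ℕ → X) : 0 ≤ muHat x g :=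
  le_limsup_of_frequently_le (Frequently.of_forall (avgA_nonneg x hg.1)) (hg.bdd x)

lemma muHat_le {g : X → ℝ} (hg : NB g) {C : ℝ} (h0 : 0 ≤ C) (hC : ∀ z, g z ≤ C) (x : ℕ → X) :
    muHat x g ≤ C :=
  limsup_le_of_le (hg.cobdd x) (Eventually.of_forall (avgA_le x h0 hC))

lemma muHat_add_le {g h : X → ℝ} (hg : NB g) (hh : NB h) (x : ℕ → X) :
    muHat x (fun z => g z + h z) ≤ muHat x g + muHat x h := by
  have := limsup_add_le (hg.bdd' x) (hg.bdd x) (hh.cobdd x) (hh.bdd x)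
  have e : avgA x (fun z => g z + h z) = avgA x g + avgA x h := by
    funext n
    simp [avgA, Finset.sum_add_distrib, add_div]
  rw [muHat_eq, e]
  exact this

lemma muHat_cmul {g : X → ℝ} (hg : NB g) {c : ℝ} (hc : 0 ≤ c) (x : ℕ → X) :
    muHat x (fun z => c * g z) = c * muHat x g := by
  have := Monotone.map_limsup_of_continuousAt (f := fun y : ℝ => c * y) (F := atTop)
    (fun a b hab => mul_le_mul_of_nonneg_left hab hc) (avgA x g)
    (by fun_prop) (hg.bdd x) (hg.cobdd x)
  rw [muHat_eq, muHat_eq, this]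
  congr 1
  funext n
  simp [avgA, ← Finset.mul_sum, mul_div_assoc]

variable [MeasurableSpace X]

lemma measurable_avgA {g : X → ℝ} (hg : Measurable g) (n : ℕ) :
    Measurable (fun x : ℕ → X => avgA x g n) := by
  unfold avgA
  fun_prop

lemma measurable_muHat {g : X → ℝ} (hg : Measurable g) :
    Measurable (fun x : ℕ → X => muHat x g) :=
  Measurable.limsup (fun n => measurable_avgA hg n)

variable (μ : Measure (ℕ → X)) [IsProbabilityMeasure μ]

lemma integrable_muHat {g : X → ℝ} (hg : Measurable g) (hb : NB g) :
    Integrable (fun x : ℕ → X => muHat x g) μ := by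
  obtain ⟨C, h0, hC⟩ := hb.exC
  refine Integrable.of_bound (measurable_muHat hg).aestronglyMeasurable C
    (Eventually.of_forall fun x => ?_)
  rw [Real.norm_of_nonneg (muHat_nonneg hb x)]
  exact muHat_le hb h0 hC x

noncomputable def phi (g : X → ℝ) : ℝ := ∫ x, muHat x g ∂μ

lemma phi_nonneg {g : X → ℝ} (hb : NB g) : 0 ≤ phi μ g :=
  integral_nonneg fun x => muHat_nonneg hb x

lemma phi_mono {g h : X → ℝ} (hg : Measurable g) (hh : Measurable h) (bg : NB g) (bh : NB h)
    (hgh : ∀ z, g z ≤ h z) : phi μ g ≤ phi μ h :=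
  integral_mono (integrable_muHat μ hg bg) (integrable_muHat μ hh bh) (muHat_mono bg bh hgh)

lemma phi_le {g : X → ℝ} (hg : Measurable g) (bg : NB g) {C : ℝ} (h0 : 0 ≤ C)
    (hC : ∀ z, g z ≤ C) : phi μ g ≤ C := by
  have := integral_mono (integrable_muHat μ hg bg) (integrable_const C) (muHat_le bg h0 hC)
  rw [integral_const] at this
  simp only [probReal_univ, one_smul] at this
  exact this

lemma phi_cmul {g : X → ℝ} (bg : NB g) {c : ℝ} (hc : 0 ≤ c) :
    phi μ (fun z => c * g z) = c * phi μ g := by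
  unfold phi
  rw [← integral_const_mul]
  congr 1
  funext x
  exact muHat_cmul bg hc x

lemma phi_add {g h k : X → ℝ} (hg : Measurable g) (hh : Measurable h) (hk : Measurable k)
    (bg : NB g) (bh : NB h) (bk : NB k)
    (hgh : ∀ z, k z ≤ g z + h z) : phi μ k ≤ phi μ g + phi μ h := by
  refine (phi_mono μ hk (hg.add hh) bk (bg.add bh) hgh).trans ?_
  unfold phi
  rw [← integral_add (integrable_muHat μ hg bg) (integrable_muHat μ hh bh)]
  exact integral_mono (integrable_muHat μ (hg.add hh) (bg.add bh))
    ((integrable_muHat μ hg bg).add (integrable_muHat μ hh bh)) (muHat_add_le bg bh)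

noncomputable def phiS (A : Set X) : ℝ := phi μ (A.indicator fun _ => (1 : ℝ))

lemma meas_ind {A : Set X} (hA : MeasurableSet A) : Measurable (A.indicator fun _ => (1 : ℝ)) :=
  measurable_const.indicator hA

lemma phiS_nonneg (A : Set X) : 0 ≤ phiS μ A := phi_nonneg μ (NB.ind A)

lemma phiS_mono {A B : Set X} (hA : MeasurableSet A) (hB : MeasurableSet B) (h : A ⊆ B) :
    phiS μ A ≤ phiS μ B :=
  phi_mono μ (meas_ind hA) (meas_ind hB) (NB.ind A) (NB.ind B)
    (Set.indicator_le_indicator_of_subset h (fun _ => zero_le_one))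

lemma phiS_union {A B D : Set X} (hA : MeasurableSet A) (hB : MeasurableSet B)
    (hD : MeasurableSet D) (h : D ⊆ A ∪ B) :
    phiS μ D ≤ phiS μ A + phiS μ B := by
  refine phi_add μ (meas_ind hA) (meas_ind hB) (meas_ind hD) (NB.ind A) (NB.ind B) (NB.ind D) ?_
  intro z
  have := @h z
  by_cases h1 : z ∈ A <;> by_cases h2 : z ∈ B <;> by_cases h3 : z ∈ D <;> simp_all

lemma approx_union {T : Set (Set X)} (hT : IsSetAlgebra T) (hm : ∀ G ∈ T, MeasurableSet G)
    {A B : Set X} (hA : MeasurableSet A) (hB : MeasurableSet B)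
    (pA : ∀ ε > 0, ∃ G ∈ T, phiS μ (symmDiff G A) < ε)
    (pB : ∀ ε > 0, ∃ G ∈ T, phiS μ (symmDiff G B) < ε) :
    ∀ ε > 0, ∃ G ∈ T, phiS μ (symmDiff G (A ∪ B)) < ε := by
  intro ε hε
  obtain ⟨G, hG, h1⟩ := pA (ε / 2) (by linarith)
  obtain ⟨H, hH, h2⟩ := pB (ε / 2) (by linarith)
  refine ⟨G ∪ H, hT.union_mem hG hH, ?_⟩
  have := phiS_union μ ((hm G hG).symmDiff hA) ((hm H hH).symmDiff hB)
    (((hm G hG).union (hm H hH)).symmDiff (hA.union hB)) (by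
      intro z
      simp only [Set.mem_symmDiff, Set.mem_union]
      tauto)
  linarith

lemma approx_sets [TopologicalSpace X] [SecondCountableTopology X] [BorelSpace X]
    (h : Condition1 μ) : ∃ T : Set (Set X), T.Countable ∧ (∀ G ∈ T, MeasurableSet G) ∧
      ∀ A, MeasurableSet A → ∀ ε > 0, ∃ G ∈ T, phiS μ (symmDiff G A) < ε := by
  set b := TopologicalSpace.countableBasis X with hb
  have hgen : ‹MeasurableSpace X› = MeasurableSpace.generateFrom b := by
    rw [BorelSpace.measurable_eq (α := X)]
    exact (TopologicalSpace.isBasis_countableBasis X).borel_eq_generateFrom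
  have hT : IsSetAlgebra (generateSetAlgebra b) := isSetAlgebra_generateSetAlgebra
  have hm : ∀ G ∈ generateSetAlgebra b, MeasurableSet G := by
    intro G hG
    rw [hgen, ← generateFrom_generateSetAlgebra_eq]
    exact MeasurableSpace.measurableSet_generateFrom hG
  have empt : phiS μ (∅ : Set X) ≤ 0 :=
    phi_le μ (meas_ind MeasurableSet.empty) (NB.ind _) le_rfl (by simp)
  refine ⟨generateSetAlgebra b,
    countable_generateSetAlgebra (TopologicalSpace.countable_countableBasis X), hm, ?_⟩
  intro A hA
  have self : ∀ G ∈ generateSetAlgebra b,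
      ∀ ε > 0, ∃ H ∈ generateSetAlgebra b, phiS μ (symmDiff H G) < ε := by
    intro G hG ε hε
    refine ⟨G, hG, ?_⟩
    rw [symmDiff_self]
    exact lt_of_le_of_lt empt hε
  have hA' : MeasurableSet[MeasurableSpace.generateFrom b] A := by rw [← hgen]; exact hA
  have main := MeasurableSpace.generateFrom_induction b
    (fun s _ => ∀ ε > 0, ∃ G ∈ generateSetAlgebra b, phiS μ (symmDiff G s) < ε)
    (fun t ht _ => self t (self_subset_generateSetAlgebra ht))
    (self ∅ hT.empty_mem) ?_ ?_ A hA'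
  · exact main
  · intro t _ ih ε hε
    obtain ⟨G, hG, h1⟩ := ih ε hε
    refine ⟨Gᶜ, hT.compl_mem hG, ?_⟩
    rwa [compl_symmDiff_compl]
  · intro s hs ih ε hε
    have hs' : ∀ n, MeasurableSet (s n) := fun n => by rw [hgen]; exact hs n
    have hU : MeasurableSet (⋃ i, s i) := MeasurableSet.iUnion hs'
    set P : ℕ → Set X := fun k => ⋃ i, ⋃ (_ : i < k), s i with hP
    have hPm : ∀ k, MeasurableSet (P k) := fun k =>
      MeasurableSet.iUnion fun i => MeasurableSet.iUnion fun _ => hs' i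
    have hPap : ∀ k, ∀ ε > 0, ∃ G ∈ generateSetAlgebra b, phiS μ (symmDiff G (P k)) < ε := by
      intro k
      induction k with
      | zero =>
        have : P 0 = ∅ := by simp [hP]
        rw [this]
        exact self ∅ hT.empty_mem
      | succ k ihk =>
        have : P (k + 1) = P k ∪ s k := by
          simp only [hP]
          exact Set.biUnion_lt_succ s k
        rw [this]
        exact approx_union μ hT hm (hPm k) (hs' k) ihk (ih k)
    have hlim := h (fun k => (⋃ i, s i) \ P k) (fun k => hU.diff (hPm k)) (by
      intro k l hkl z hz
      simp only [hP, Set.mem_sdiff, Set.mem_iUnion, not_exists] at hz ⊢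
      exact ⟨hz.1, fun i hi => hz.2 i (lt_of_lt_of_le hi hkl)⟩) (by
      ext z
      simp only [hP, Set.mem_iInter, Set.mem_sdiff, Set.mem_iUnion, not_exists,
        Set.mem_empty_iff_false, iff_false, not_forall]
      by_cases hz : ∃ i, z ∈ s i
      · obtain ⟨i, hi⟩ := hz
        exact ⟨i + 1, fun hh => hh.2 i (Nat.lt_succ_self i) hi⟩
      · exact ⟨0, fun hh => hz hh.1⟩)
    obtain ⟨k, hk⟩ := (hlim.eventually_lt_const (show (0 : ℝ) < ε / 2 by linarith)).exists
    have hk' : phiS μ ((⋃ i, s i) \ P k) < ε / 2 := hk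
    obtain ⟨G, hG, h1⟩ := hPap k (ε / 2) (by linarith)
    refine ⟨G, hG, ?_⟩
    have hsub : P k ⊆ ⋃ i, s i := by
      intro z hz
      simp only [hP, Set.mem_iUnion] at hz ⊢
      obtain ⟨i, _, hi⟩ := hz
      exact ⟨i, hi⟩
    have := phiS_union μ (hU.diff (hPm k)) ((hm G hG).symmDiff (hPm k))
      ((hm G hG).symmDiff hU) (by
        intro z
        have := @hsub z
        simp only [Set.mem_symmDiff, Set.mem_union, Set.mem_sdiff]
        tauto)
    linarith

variable {Y : Type*} [MetricSpace Y] [MeasurableSpace Y]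

open Classical in
noncomputable def gL (y0 : Y) : List (Set X × Y) → X → Y
  | [] => fun _ => y0
  | p :: L => fun z => if z ∈ p.1 then p.2 else gL y0 L z

lemma measurable_gL (y0 : Y) (L : List (Set X × Y)) (hL : ∀ p ∈ L, MeasurableSet p.1) :
    Measurable (gL y0 L) := by
  classical
  induction L with
  | nil => exact measurable_const
  | cons p L ih =>
    have : Measurable (fun z => if z ∈ p.1 then p.2 else gL y0 L z) :=
      Measurable.ite (hL p (by simp)) measurable_const
        (ih fun q hq => hL q (by simp [hq]))
    exact this

lemma gL_eq_or (y0 : Y) (P : Y → Prop) (L : List (Set X × Y)) (z : X)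
    (hex : ∃ p ∈ L, z ∈ p.1) (hP : ∀ p ∈ L, z ∈ p.1 → P p.2) : P (gL y0 L z) := by
  classical
  induction L with
  | nil => simp at hex
  | cons p L ih =>
    by_cases hz : z ∈ p.1
    · simpa [gL, hz] using hP p (by simp) hz
    · simp only [gL, hz, if_false]
      apply ih
      · obtain ⟨q, hq, hzq⟩ := hex
        rcases List.mem_cons.1 hq with rfl | hq
        · exact absurd hzq hz
        · exact ⟨q, hq, hzq⟩
      · exact fun q hq => hP q (by simp [hq])

lemma NB_dist {C : ℝ} (hC : ∀ y₁ y₂ : Y, dist y₁ y₂ ≤ C) (f g : X → Y) :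
    NB (fun z => dist (f z) (g z)) := ⟨fun _ => dist_nonneg, C, fun _ => hC _ _⟩

lemma gL_approx [BorelSpace Y] [SecondCountableTopology Y]
    {C : ℝ} (hC0 : 0 ≤ C) (hC : ∀ y₁ y₂ : Y, dist y₁ y₂ ≤ C) (y0 : Y) {T : Set (Set X)}
    (hm : ∀ G ∈ T, MeasurableSet G)
    (hT : ∀ A, MeasurableSet A → ∀ ε > 0, ∃ G ∈ T, phiS μ (symmDiff G A) < ε)
    (D : Set Y) (L : List (Set X × Y)) (hL : ∀ p ∈ L, MeasurableSet p.1 ∧ p.2 ∈ D) :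
    ∀ ε > 0, ∃ L' : List (Set X × Y), (∀ p ∈ L', p.1 ∈ T ∧ p.2 ∈ D) ∧
      phi μ (fun z => dist (gL y0 L' z) (gL y0 L z)) < ε := by
  classical
  induction L with
  | nil =>
    intro ε hε
    refine ⟨[], by simp, lt_of_le_of_lt ?_ hε⟩
    exact phi_le μ (by simp) (NB_dist hC _ _) le_rfl (by simp)
  | cons p L ih =>
    intro ε hε
    obtain ⟨L', hL', h1⟩ := ih (fun q hq => hL q (by simp [hq])) (ε / 2) (by linarith)
    obtain ⟨G, hG, h2⟩ := hT p.1 (hL p (by simp)).1 (ε / 2 / (C + 1)) (by positivity)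
    refine ⟨(G, p.2) :: L', ?_, ?_⟩
    · intro q hq
      rcases List.mem_cons.1 hq with rfl | hq
      · exact ⟨hG, (hL p (by simp)).2⟩
      · exact hL' q hq
    · have mL := measurable_gL y0 L (fun q hq => (hL q (by simp [hq])).1)
      have mpL := measurable_gL y0 (p :: L) (fun q hq => (hL q hq).1)
      have mL' := measurable_gL y0 L' (fun q hq => hm _ (hL' q hq).1)
      have mGL' := measurable_gL y0 ((G, p.2) :: L') (fun q hq => by
        rcases List.mem_cons.1 hq with rfl | hq
        · exact hm _ hG
        · exact hm _ (hL' q hq).1)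
      have hS := (hm G hG).symmDiff (hL p (by simp)).1
      have key := phi_add μ (g := fun z => (C + 1) * (symmDiff G p.1).indicator (fun _ => (1 : ℝ)) z)
        (h := fun z => dist (gL y0 L' z) (gL y0 L z))
        (k := fun z => dist (gL y0 ((G, p.2) :: L') z) (gL y0 (p :: L) z))
        ((meas_ind hS).const_mul _) (mL'.dist mL) (mGL'.dist mpL)
        ((NB.ind _).cmul (by linarith)) (NB_dist hC _ _) (NB_dist hC _ _) (by
          intro z
          have d0 : 0 ≤ dist (gL y0 L' z) (gL y0 L z) := dist_nonneg
          have dC := hC (gL y0 ((G, p.2) :: L') z) (gL y0 (p :: L) z)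
          by_cases hz : z ∈ symmDiff G p.1
          · rw [Set.indicator_of_mem hz]
            linarith
          · rw [Set.indicator_of_notMem hz]
            rw [Set.mem_symmDiff] at hz
            by_cases a : z ∈ G
            · have b : z ∈ p.1 := by tauto
              simp [gL, a, b]
            · have b : z ∉ p.1 := by tauto
              simp [gL, a, b])
      rw [phi_cmul μ (NB.ind _) (by linarith)] at key
      change _ ≤ (C + 1) * phiS μ _ + _ at key
      rw [lt_div_iff₀ (by linarith)] at h2
      linarith

lemma forward [TopologicalSpace X] [SecondCountableTopology X] [BorelSpace X]
    [BorelSpace Y] [SecondCountableTopology Y] [Nonempty Y]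
    {C : ℝ} (hC : ∀ y₁ y₂ : Y, dist y₁ y₂ ≤ C) (h : Condition1 μ) :
    ∃ u : ℕ → X → Y, (∀ i, Measurable (u i)) ∧ ∀ f : X → Y, Measurable f → ∀ ε > 0,
      ∃ i, phi μ (fun z => dist (u i z) (f z)) < ε := by
  classical
  obtain ⟨T, hTc, hm, hT⟩ := approx_sets μ h
  obtain ⟨y0⟩ := ‹Nonempty Y›
  have hC0 : 0 ≤ C := dist_nonneg.trans (hC y0 y0)
  have : Nonempty Y := ⟨y0⟩
  let d := TopologicalSpace.denseSeq Y
  let D : Set Y := Set.range d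
  let 𝓛 : Set (List (Set X × Y)) := {L | ∀ p ∈ L, p ∈ T ×ˢ D}
  have hcount : 𝓛.Countable := by
    have hc : (T ×ˢ D).Countable := hTc.prod (Set.countable_range d)
    have : Countable ↥(T ×ˢ D) := hc.to_subtype
    have h2 := Set.countable_range (List.map ((↑) : ↥(T ×ˢ D) → Set X × Y))
    rw [Set.range_list_map_coe] at h2
    exact h2
  have hne : 𝓛.Nonempty := ⟨[], by simp [𝓛]⟩
  obtain ⟨e, he⟩ := hcount.exists_eq_range hne
  have heL : ∀ i, e i ∈ 𝓛 := fun i => he ▸ Set.mem_range_self i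
  have hum : ∀ i, Measurable (gL y0 (e i)) :=
    fun i => measurable_gL y0 _ (fun p hp => hm _ (heL i p hp).1)
  refine ⟨fun i => gL y0 (e i), hum, ?_⟩
  intro f hf ε hε
  let B : ℕ → Set X := fun j => f ⁻¹' Metric.ball (d j) (ε / 4)
  have hB : ∀ j, MeasurableSet (B j) := fun j => hf Metric.isOpen_ball.measurableSet
  let A : ℕ → Set X := fun k => ⋂ i, ⋂ (_ : i < k), (B i)ᶜ
  have hA : ∀ k, MeasurableSet (A k) := fun k =>
    MeasurableSet.iInter fun i => MeasurableSet.iInter fun _ => (hB i).compl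
  have hlim := h A hA (by
    intro k l hkl z hz
    simp only [A, Set.mem_iInter] at hz ⊢
    exact fun i hi => hz i (lt_of_lt_of_le hi hkl)) (by
    ext z
    simp only [A, Set.mem_iInter, Set.mem_empty_iff_false, iff_false, not_forall]
    obtain ⟨j, hj⟩ := (TopologicalSpace.denseRange_denseSeq Y).exists_dist_lt (f z)
      (show (0 : ℝ) < ε / 4 by linarith)
    exact ⟨j + 1, j, Nat.lt_succ_self j, fun hh => hh hj⟩)
  obtain ⟨k, hk⟩ := (hlim.eventually_lt_const
    (show (0 : ℝ) < ε / 4 / (C + 1) by positivity)).exists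
  replace hk : phiS μ (A k) < ε / 4 / (C + 1) := hk
  rw [lt_div_iff₀ (by linarith)] at hk
  let L : List (Set X × Y) := (List.range k).map (fun j => (B j, d j))
  have hLm : ∀ p ∈ L, MeasurableSet p.1 ∧ p.2 ∈ D := by
    intro p hp
    simp only [L, List.mem_map] at hp
    obtain ⟨j, _, rfl⟩ := hp
    exact ⟨hB j, Set.mem_range_self j⟩
  obtain ⟨L', hL', h1⟩ := gL_approx μ hC0 hC y0 hm hT D L hLm (ε / 4) (by linarith)
  have : L' ∈ 𝓛 := fun p hp => hL' p hp
  rw [he] at this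
  obtain ⟨i, rfl⟩ := this
  refine ⟨i, ?_⟩
  have mL := measurable_gL y0 L (fun p hp => (hLm p hp).1)
  have k1 := phi_add μ ((hum i).dist mL) (mL.dist hf) ((hum i).dist hf)
    (NB_dist hC _ _) (NB_dist hC _ _) (NB_dist hC _ _) (fun z => dist_triangle _ _ _)
  have bc : NB (fun _ : X => ε / 4) := ⟨fun _ => by linarith, ε / 4, fun _ => le_rfl⟩
  have k2 := phi_add μ (g := fun _ : X => ε / 4)
    (h := fun z => (C + 1) * (A k).indicator (fun _ => (1 : ℝ)) z)
    (k := fun z => dist (gL y0 L z) (f z))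
    measurable_const ((meas_ind (hA k)).const_mul _) (mL.dist hf)
    bc ((NB.ind _).cmul (by linarith)) (NB_dist hC _ _) (by
      intro z
      by_cases hz : z ∈ A k
      · rw [Set.indicator_of_mem hz]
        have := hC (gL y0 L z) (f z)
        linarith
      · rw [Set.indicator_of_notMem hz]
        simp only [A, Set.mem_iInter, not_forall, Set.mem_compl_iff, not_not] at hz
        obtain ⟨j, hj, hz⟩ := hz
        have := gL_eq_or y0 (fun y => dist y (f z) < ε / 4) L z
          ⟨(B j, d j), by simp [L]; exact ⟨j, hj, rfl, rfl⟩, hz⟩ (by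
            intro p hp hzp
            simp only [L, List.mem_map] at hp
            obtain ⟨j, _, rfl⟩ := hp
            rw [dist_comm]
            exact hzp)
        linarith)
  rw [phi_cmul μ (NB.ind _) (by linarith)] at k2
  change _ ≤ _ + (C + 1) * phiS μ _ at k2
  have k3 := phi_le μ (g := fun _ : X => ε / 4) measurable_const bc (by linarith)
    (fun _ => le_rfl)
  linarith

lemma step_exists {A : ℕ → Set X} (hA : ∀ k, MeasurableSet (A k)) (hanti : Antitone A)
    (hemp : (⋂ k, A k) = ∅) {c : ℝ} (hc : 0 < c) (hphi : ∀ k, c ≤ phiS μ (A k)) (k N : ℕ) :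
    ∃ m > k, c / 4 < μ.real {x | ∃ n ≥ N, c / 2 <
      avgA x ((A k \ A m).indicator fun _ => (1 : ℝ)) n} := by
  let V : ℕ → Set (ℕ → X) := fun m => {x | ∃ n ≥ N, c / 2 <
      avgA x ((A k \ A m).indicator fun _ => (1 : ℝ)) n}
  have hVmono : Monotone V := by
    rintro m m' hmm x ⟨n, hn, h⟩
    refine ⟨n, hn, h.trans_le (avgA_mono x ?_ n)⟩
    exact Set.indicator_le_indicator_of_subset
      (fun z hz => ⟨hz.1, fun h' => hz.2 (hanti hmm h')⟩) (fun _ => zero_le_one)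
  let U : Set (ℕ → X) := {x | c / 2 < muHat x ((A k).indicator fun _ => (1 : ℝ))}
  have hUm : MeasurableSet U := measurableSet_lt measurable_const (measurable_muHat (meas_ind (hA k)))
  have hU : c / 2 ≤ μ.real U := by
    have h1 : phiS μ (A k) ≤ ∫ x, (c / 2 + U.indicator (fun _ => (1 : ℝ)) x) ∂μ := by
      refine integral_mono (integrable_muHat μ (meas_ind (hA k)) (NB.ind _))
        ((integrable_const _).add ((integrable_const _).indicator hUm)) ?_
      intro x
      change muHat x ((A k).indicator fun _ => (1 : ℝ)) ≤ c / 2 + U.indicator (fun _ => (1 : ℝ)) x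
      by_cases hx : x ∈ U
      · rw [Set.indicator_of_mem hx]
        have := muHat_le (NB.ind (A k)) zero_le_one (fun z =>
          Set.indicator_le_self' (fun _ _ => zero_le_one) z) x
        linarith
      · rw [Set.indicator_of_notMem hx]
        have : ¬ (c / 2 < muHat x ((A k).indicator fun _ => (1 : ℝ))) := hx
        linarith
    rw [integral_add (integrable_const _) ((integrable_const _).indicator hUm),
      integral_const, integral_indicator_const _ hUm] at h1
    simp only [probReal_univ, smul_eq_mul, one_mul, mul_one] at h1
    linarith [hphi k]
  have hsub : U ⊆ ⋃ m, V m := by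
    intro x hx
    have hf : ∃ᶠ n in atTop, c / 2 < avgA x ((A k).indicator fun _ => (1 : ℝ)) n :=
      frequently_lt_of_lt_limsup ((NB.ind _).cobdd x) hx
    obtain ⟨n, hn, h⟩ := (frequently_atTop.1 hf) N
    have : ∃ m, ∀ t < n, x t ∉ A m := by
      clear h hn
      induction n with
      | zero => exact ⟨0, by simp⟩
      | succ n ih =>
        obtain ⟨m, hm⟩ := ih
        have : x n ∉ ⋂ k, A k := by rw [hemp]; simp
        simp only [Set.mem_iInter, not_forall] at this
        obtain ⟨m', hm'⟩ := this
        refine ⟨max m m', fun t ht hh => ?_⟩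
        rcases Nat.lt_succ_iff_lt_or_eq.1 ht with h | rfl
        · exact hm t h (hanti (le_max_left _ _) hh)
        · exact hm' (hanti (le_max_right _ _) hh)
    obtain ⟨m, hm⟩ := this
    refine Set.mem_iUnion.2 ⟨m, n, hn, h.trans_le (le_of_eq ?_)⟩
    unfold avgA
    congr 1
    refine Finset.sum_congr rfl fun t ht => ?_
    have := hm t (Finset.mem_range.1 ht)
    by_cases h2 : x t ∈ A k <;> simp [h2, this]
  have hlim := tendsto_measure_iUnion_atTop (μ := μ) hVmono
  have hlim' : Tendsto (fun m => μ.real (V m)) atTop (𝓝 (μ.real (⋃ m, V m))) :=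
    (ENNReal.tendsto_toReal (measure_ne_top μ _)).comp hlim
  have hlt : c / 4 < μ.real (⋃ m, V m) := by
    have := measureReal_mono (μ := μ) hsub
    linarith
  obtain ⟨m, hm, hm2⟩ := ((hlim'.eventually_const_lt hlt).and (eventually_gt_atTop k)).exists
  exact ⟨m, hm2, hm⟩

lemma shells {A : ℕ → Set X} (hA : ∀ k, MeasurableSet (A k)) (hanti : Antitone A)
    (hemp : (⋂ k, A k) = ∅) {c : ℝ} (hc : 0 < c) (hphi : ∀ k, c ≤ phiS μ (A k)) :
    ∃ E : ℕ → Set X, (∀ j, MeasurableSet (E j)) ∧ (∀ i j z, z ∈ E i → z ∈ E j → i = j) ∧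
      ∃ δ > 0, ∀ K : ℕ → Prop, (∀ N, ∃ k ≥ N, K k) → ∀ S, MeasurableSet S →
        (∀ k, K k → E k ⊆ S) → δ ≤ phiS μ S := by
  choose nx hnx1 hnx2 using step_exists μ hA hanti hemp hc hphi
  let m : ℕ → ℕ := fun j => Nat.rec 0 (fun _ p => nx p p) j
  have hms : ∀ j, m (j + 1) = nx (m j) (m j) := fun j => rfl
  have hmono : StrictMono m := strictMono_nat_of_lt_succ fun j => by
    rw [hms]; exact hnx1 _ _
  let E : ℕ → Set X := fun j => A (m j) \ A (m (j + 1))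
  have hdis : ∀ i j z, i < j → z ∈ E i → z ∈ E j → False := by
    intro i j z hij hi hj
    exact hi.2 (hanti (hmono.monotone hij) hj.1)
  refine ⟨E, fun j => (hA _).diff (hA _), ?_, c / 2 * (c / 4), by positivity, ?_⟩
  · intro i j z hi hj
    rcases lt_trichotomy i j with h | h | h
    · exact (hdis i j z h hi hj).elim
    · exact h
    · exact (hdis j i z h hj hi).elim
  intro K hK S hS hKS
  let g : X → ℝ := S.indicator fun _ => (1 : ℝ)
  let W : ℕ → Set (ℕ → X) := fun N => {x | ∃ n ≥ N, c / 2 < avgA x g n}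
  have hWm : ∀ N, MeasurableSet (W N) := by
    intro N
    have : W N = ⋃ n, ⋃ (_ : n ≥ N), {x | c / 2 < avgA x g n} := by
      ext x
      simp [W]
    rw [this]
    exact MeasurableSet.iUnion fun n => MeasurableSet.iUnion fun _ =>
      measurableSet_lt measurable_const (measurable_avgA (meas_ind hS) n)
  have hWanti : Antitone W := by
    rintro N N' h x ⟨n, hn, hh⟩
    exact ⟨n, h.trans hn, hh⟩
  have hWge : ∀ N, c / 4 ≤ μ.real (W N) := by
    intro N
    obtain ⟨k, hk, hKk⟩ := hK N
    refine (hnx2 (m k) (m k)).le.trans (measureReal_mono ?_)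
    rintro x ⟨n, hn, h⟩
    refine ⟨n, hk.trans ((hmono.id_le k).trans hn), h.trans_le (avgA_mono x ?_ n)⟩
    exact Set.indicator_le_indicator_of_subset (hKS k hKk) (fun _ => zero_le_one)
  have hlim := tendsto_measure_iInter_atTop (μ := μ) (fun N => (hWm N).nullMeasurableSet) hWanti
    ⟨0, measure_ne_top μ _⟩
  have hlim' : Tendsto (fun N => μ.real (W N)) atTop (𝓝 (μ.real (⋂ N, W N))) :=
    (ENNReal.tendsto_toReal (measure_ne_top μ _)).comp hlim
  have hge : c / 4 ≤ μ.real (⋂ N, W N) := ge_of_tendsto' hlim' hWge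
  have hIm : MeasurableSet (⋂ N, W N) := MeasurableSet.iInter hWm
  have h1 : ∫ x, (⋂ N, W N).indicator (fun _ => c / 2) x ∂μ ≤ phiS μ S := by
    refine integral_mono ((integrable_const _).indicator hIm)
      (integrable_muHat μ (meas_ind hS) (NB.ind _)) ?_
    intro x
    by_cases hx : x ∈ ⋂ N, W N
    · rw [Set.indicator_of_mem hx]
      refine le_limsup_of_frequently_le (frequently_atTop.2 fun N => ?_) ((NB.ind S).bdd x)
      obtain ⟨n, hn, h⟩ := Set.mem_iInter.1 hx N
      exact ⟨n, hn, h.le⟩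
    · rw [Set.indicator_of_notMem hx]
      exact muHat_nonneg (NB.ind S) x
  rw [integral_indicator_const _ hIm, smul_eq_mul] at h1
  nlinarith

lemma backward [BorelSpace Y] [SecondCountableTopology Y]
    {C : ℝ} (hC : ∀ y₁ y₂ : Y, dist y₁ y₂ ≤ C) {a b : Y} (hab : 0 < dist a b)
    (P : (X → Y) → Prop) (hP : ∀ g, P g → Measurable g)
    (hcount : {g | P g}.Countable)
    (happ : ∀ f : X → Y, Measurable f → ∀ ε > 0, ∃ g, P g ∧
      phi μ (fun z => dist (g z) (f z)) < ε) : Condition1 μ := by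
  classical
  intro A hA hanti hemp
  by_contra hnot
  have hph : Antitone (fun k => phiS μ (A k)) := fun i j hij =>
    phiS_mono μ (hA j) (hA i) (hanti hij)
  have : ∃ c > 0, ∀ k, c ≤ phiS μ (A k) := by
    by_contra hcon
    push Not at hcon
    apply hnot
    change Tendsto (fun k => phiS μ (A k)) atTop (𝓝 0)
    rw [Metric.tendsto_atTop]
    intro ε hε
    obtain ⟨k, hk⟩ := hcon ε hε
    refine ⟨k, fun n hn => ?_⟩
    rw [Real.dist_eq, sub_zero, abs_of_nonneg (phiS_nonneg μ _)]
    exact (hph hn).trans_lt hk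
  obtain ⟨c, hc, hphi⟩ := this
  obtain ⟨E, hE, hdis, δ, hδ, hkey⟩ := shells μ hA hanti hemp hc hphi
  let B : Set ℕ → Set X := fun s => ⋃ j, ⋃ (_ : (Nat.unpair j).1 ∈ s), E j
  have hB : ∀ s, MeasurableSet (B s) := fun s =>
    MeasurableSet.iUnion fun j => MeasurableSet.iUnion fun _ => hE j
  have hmemB : ∀ s j z, z ∈ E j → (z ∈ B s ↔ (Nat.unpair j).1 ∈ s) := by
    intro s j z hz
    simp only [B, Set.mem_iUnion]
    constructor
    · rintro ⟨i, hi, hzi⟩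
      rwa [hdis j i z hz hzi]
    · exact fun h => ⟨j, h, hz⟩
  let f : Set ℕ → X → Y := fun s z => if z ∈ B s then a else b
  have hf : ∀ s, Measurable (f s) := fun s => Measurable.ite (hB s) measurable_const measurable_const
  have hε : 0 < dist a b * δ / 2 := by positivity
  choose G hGP hG using fun s => happ (f s) (hf s) _ hε
  have hinj : Function.Injective G := by
    intro s t hst
    by_contra hne
    have : ∃ i, ¬ (i ∈ s ↔ i ∈ t) := by
      by_contra hh
      push Not at hh
      exact hne (Set.ext hh)
    obtain ⟨i, hi⟩ := this
    have k1 := hkey (fun j => (Nat.unpair j).1 = i)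
      (fun N => ⟨Nat.pair i N, Nat.right_le_pair i N, by simp⟩)
      (symmDiff (B s) (B t)) ((hB s).symmDiff (hB t)) (by
        intro j hj z hz
        rw [Set.mem_symmDiff, hmemB s j z hz, hmemB t j z hz, hj]
        tauto)
    have k2 : dist a b * phiS μ (symmDiff (B s) (B t)) ≤
        phi μ (fun z => dist (G s z) (f s z)) + phi μ (fun z => dist (G t z) (f t z)) := by
      unfold phiS
      rw [← phi_cmul μ (NB.ind _) hab.le]
      refine phi_add μ ((hP _ (hGP s)).dist (hf s)) ((hP _ (hGP t)).dist (hf t))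
        ((meas_ind ((hB s).symmDiff (hB t))).const_mul _)
        (NB_dist hC _ _) (NB_dist hC _ _) ((NB.ind _).cmul hab.le) ?_
      intro z
      rw [← hst]
      by_cases hz : z ∈ symmDiff (B s) (B t)
      · rw [Set.indicator_of_mem hz, mul_one]
        have h3 : dist a b = dist (f s z) (f t z) := by
          rcases (Set.mem_symmDiff).1 hz with ⟨h1, h2⟩ | ⟨h1, h2⟩
          · simp [f, h1, h2]
          · simp [f, h1, h2, dist_comm]
        rw [h3]
        exact dist_triangle_left _ _ _
      · rw [Set.indicator_of_notMem hz, mul_zero]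
        positivity
    have := hG s
    have := hG t
    have : dist a b * δ ≤ dist a b * phiS μ (symmDiff (B s) (B t)) :=
      mul_le_mul_of_nonneg_left k1 hab.le
    linarith
  have : Countable {g | P g} := hcount.to_subtype
  obtain ⟨e, he⟩ := exists_injective_nat {g | P g}
  exact Function.cantor_injective (fun s => e ⟨G s, hGP s⟩) (fun s t hst =>
    hinj (congrArg Subtype.val (he hst)))

end Helpers

/-- **Corollary 14 (Hanneke).** A process satisfies Condition 1 iff there is a sequence
of nonempty finite sets of measurable functions `X → Y` approximating every measurable
function in expected long-run average loss. -/
theorem condition1_iff_approximating_function_sequence (X Y : Type*)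
    [TopologicalSpace X] [TopologicalSpace.MetrizableSpace X]
    [TopologicalSpace.SeparableSpace X] [Nonempty X] [MeasurableSpace X] [BorelSpace X]
    [MetricSpace Y] [TopologicalSpace.SeparableSpace Y] [Nonempty Y]
    [MeasurableSpace Y] [BorelSpace Y]
    (hbdd : ∃ C : ℝ, ∀ y₁ y₂ : Y, dist y₁ y₂ ≤ C)
    (hnontriv : ∃ y₁ y₂ : Y, 0 < dist y₁ y₂)
    (μ : Measure (ℕ → X)) (hμ : IsProbabilityMeasure μ) :
    Condition1 μ ↔
      ∃ F : ℕ → Set (X → Y),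
        (∀ i, (F i).Finite) ∧ (∀ i, (F i).Nonempty) ∧ (∀ i, ∀ g ∈ F i, Measurable g) ∧
          ∀ f : X → Y, Measurable f →
            Tendsto
              (fun i =>
                sInf ((fun g => ∫ x, muHat x (fun z => dist (g z) (f z)) ∂μ) '' F i))
              atTop (𝓝 0) := by
  letI := TopologicalSpace.metrizableSpaceMetric X
  haveI : SecondCountableTopology X := UniformSpace.secondCountable_of_separable X
  haveI : SecondCountableTopology Y := UniformSpace.secondCountable_of_separable Y
  obtain ⟨C, hC⟩ := hbdd
  obtain ⟨a, b, hab⟩ := hnontriv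
  have hbb : ∀ (f : X → Y) (S : Set (X → Y)),
      BddBelow ((fun g => ∫ x, muHat x (fun z => dist (g z) (f z)) ∂μ) '' S) := by
    rintro f S
    refine ⟨0, ?_⟩
    rintro _ ⟨g, _, rfl⟩
    exact phi_nonneg μ (NB_dist hC g f)
  constructor
  · intro h
    obtain ⟨u, hu, happ⟩ := forward μ hC h
    refine ⟨fun i => u '' Set.Iic i, fun i => (Set.finite_Iic i).image u,
      fun i => ⟨u i, i, Set.mem_Iic.2 le_rfl, rfl⟩, ?_, ?_⟩
    · rintro i _ ⟨j, _, rfl⟩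
      exact hu j
    · intro f hf
      rw [Metric.tendsto_atTop]
      intro ε hε
      obtain ⟨i, hi⟩ := happ f hf ε hε
      refine ⟨i, fun n hn => ?_⟩
      rw [Real.dist_eq, sub_zero, abs_of_nonneg]
      · exact (csInf_le (hbb f _) (Set.mem_image_of_mem _ (Set.mem_image_of_mem u (Set.mem_Iic.2 hn)))).trans_lt hi
      · apply Real.sInf_nonneg
        rintro _ ⟨g, _, rfl⟩
        exact phi_nonneg μ (NB_dist hC g f)
  · rintro ⟨F, hfin, hne, hmeas, happ⟩
    refine backward μ hC hab (fun g => g ∈ ⋃ i, F i) ?_ ?_ ?_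
    · intro g hg
      obtain ⟨i, hi⟩ := Set.mem_iUnion.1 hg
      exact hmeas i g hi
    · exact Set.countable_iUnion fun i => (hfin i).countable
    · intro f hf ε hε
      obtain ⟨i, hi⟩ := ((happ f hf).eventually_lt_const hε).exists
      obtain ⟨_, ⟨g, hg, rfl⟩, hlt⟩ := exists_lt_of_csInf_lt ((hne i).image _) hi
      exact ⟨g, Set.mem_iUnion.2 ⟨i, hg⟩, hlt⟩
end

section
/- For any nonatomic probability measure π₀ on a Polish space X (with its Borel σ-algebra B), there exists a sequence {R_k}_{k=1}^∞ of sets in B such that π₀(R_k) = 1/2 for every k, and for every A ∈ B, lim_{k→∞} π₀(A ∩ R_k) = (1/2) π₀(A). -/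
open MeasureTheory Filter Topology Set

lemma aux_half {X : Type*} [MeasurableSpace X] [StandardBorelSpace X]
    (μ : Measure X) [IsProbabilityMeasure μ] (h0 : ∀ x, μ {x} = 0) (C : Set X)
    (hC : MeasurableSet C) :
    ∃ S, S ⊆ C ∧ MeasurableSet S ∧ μ.real S = μ.real C / 2 := by
  obtain ⟨f, hf⟩ := exists_measurableEmbedding_real X
  let ν : Measure ℝ := (μ.restrict C).map f
  have hν : ∀ s, MeasurableSet s → ν.real s = μ.real (C ∩ f ⁻¹' s) := by
    intro s hs
    simp only [ν, measureReal_def]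
    rw [Measure.map_apply hf.measurable hs, Measure.restrict_apply (hf.measurable hs), inter_comm]
  have : IsFiniteMeasure ν := by
    dsimp only [ν]; exact Measure.isFiniteMeasure_map _ _
  have : NullSingletonClass ν := ⟨by
    intro y
    dsimp only [ν]
    rw [hf.map_apply]
    refine le_antisymm ((Measure.restrict_apply_le _ _).trans ?_) zero_le
    have hs : (f ⁻¹' {y}).Subsingleton := fun a ha b hb => hf.injective (by
      rw [mem_preimage, mem_singleton_iff] at ha hb
      rw [ha, hb])
    rcases hs.eq_empty_or_singleton with h | ⟨x, h⟩
    · simp [h]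
    · rw [h, h0]⟩
  have hcont : Continuous (fun t => ν.real (Iic t)) := by
    have h1 := intervalIntegral.continuous_primitive (μ := ν) (f := fun _ => (1:ℝ))
      (fun a b => intervalIntegrable_const) 0
    have h2 : (fun t => ν.real (Iic t)) = fun t => ν.real (Iic 0) + ∫ x in (0:ℝ)..t, (1:ℝ) ∂ν := by
      ext t
      rw [← intervalIntegral.integral_Iic_sub_Iic (by simp) (by simp)]
      simp
    rw [h2]
    exact continuous_const.add h1
  have htop : Tendsto (fun t => ν.real (Iic t)) atTop (𝓝 (ν.real univ)) :=
    (ENNReal.tendsto_toReal (measure_ne_top _ _)).comp (tendsto_measure_Iic_atTop ν)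
  have hbot : Tendsto (fun t => ν.real (Iic t)) atBot (𝓝 0) := by
    have := (ENNReal.tendsto_toReal (measure_ne_top _ _)).comp (tendsto_measure_iInter_atBot
      (μ := ν) (s := fun t : ℝ => Iic t) (fun i => measurableSet_Iic.nullMeasurableSet)
      monotone_Iic ⟨0, measure_ne_top _ _⟩)
    have h2 : (⋂ t : ℝ, Iic t) = ∅ := by
      refine eq_empty_iff_forall_notMem.2 fun x hx => ?_
      have := mem_iInter.1 hx (x - 1)
      rw [mem_Iic] at this
      linarith
    rw [h2, measure_empty] at this
    exact this
  have hu : ν.real univ = μ.real C := by rw [hν _ .univ]; simp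
  by_cases hc : μ.real C = 0
  · exact ⟨∅, by simp, by simp, by simp [hc]⟩
  have hpos : 0 < μ.real C := lt_of_le_of_ne measureReal_nonneg (Ne.symm hc)
  obtain ⟨t, ht⟩ := mem_range_of_exists_le_of_exists_ge hcont
    (hbot.eventually (ge_mem_nhds (half_pos hpos))).exists
    (htop.eventually (le_mem_nhds (by rw [hu]; exact half_lt_self hpos))).exists
  refine ⟨C ∩ f ⁻¹' Iic t, inter_subset_left, hC.inter (hf.measurable measurableSet_Iic), ?_⟩
  rw [← hν _ measurableSet_Iic]
  exact ht

lemma hasSum_measureReal_iUnion {X : Type*} [MeasurableSpace X]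
    {μ : Measure X} [IsProbabilityMeasure μ] {f : ℕ → Set X}
    (hd : Pairwise (Function.onFun Disjoint f)) (hf : ∀ i, MeasurableSet (f i)) :
    HasSum (fun i => μ.real (f i)) (μ.real (⋃ i, f i)) := by
  have h := measure_iUnion (μ := μ) hd hf
  have h1 : ∑' i, μ (f i) ≠ ⊤ := h ▸ measure_ne_top _ _
  have h2 := ENNReal.hasSum_toReal h1
  have h3 := ENNReal.tsum_toReal_eq (fun i => measure_ne_top μ (f i))
  simp only [measureReal_def]
  rw [h]
  first | exact h2 | (rw [h3]; exact h2)

lemma aux_lim {X : Type*} {m m0 : MeasurableSpace X} (hm : m ≤ m0)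
    (μ : Measure X) [IsProbabilityMeasure μ] (P : Set (Set X)) (hP : IsPiSystem P)
    (hmP : m = MeasurableSpace.generateFrom P) (R : ℕ → Set X)
    (hR : ∀ k, MeasurableSet (R k))
    (hu : ∀ k, μ.real (R k) = 1 / 2)
    (h : ∀ A ∈ P, Tendsto (fun k => μ.real (A ∩ R k)) atTop (𝓝 (μ.real A / 2)))
    (A : Set X) (hA : MeasurableSet[m] A) :
    Tendsto (fun k => μ.real (A ∩ R k)) atTop (𝓝 (μ.real A / 2)) := by
  induction A, hA using MeasurableSpace.induction_on_inter hmP hP with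
  | empty => simp
  | basic t ht => exact h t ht
  | compl t ht ih =>
    have e : ∀ k, μ.real (tᶜ ∩ R k) = 1 / 2 - μ.real (t ∩ R k) := by
      intro k
      have := measureReal_inter_add_sdiff (μ := μ) (s := R k) (hm _ ht)
      rw [hu k, inter_comm, sdiff_eq, inter_comm (R k)] at this
      linarith
    simp_rw [e]
    rw [probReal_compl_eq_one_sub (hm _ ht), sub_div]
    exact tendsto_const_nhds.sub ih
  | iUnion f hd hf ih =>
    have hs : HasSum (fun i => μ.real (f i)) (μ.real (⋃ i, f i)) := by
      exact hasSum_measureReal_iUnion hd (fun i => hm _ (hf i))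
    have e : ∀ k, μ.real ((⋃ i, f i) ∩ R k) = ∑' i, μ.real (f i ∩ R k) := by
      intro k
      rw [iUnion_inter]
      refine (HasSum.tsum_eq ?_).symm
      exact hasSum_measureReal_iUnion
        (fun i j hij => (hd hij).mono inter_subset_left inter_subset_left)
        (fun i => (hm _ (hf i)).inter (hR k))
    simp_rw [e]
    rw [← (hs.div_const 2).tsum_eq]
    refine tendsto_tsum_of_dominated_convergence hs.summable ih (.of_forall fun k i => ?_)
    rw [Real.norm_of_nonneg measureReal_nonneg]
    exact measureReal_mono inter_subset_left

open ProbabilityTheory MeasurableSpace in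
lemma aux_step {X : Type*} [MeasurableSpace X] [StandardBorelSpace X]
    (μ : Measure X) [IsProbabilityMeasure μ] (h0 : ∀ x, μ {x} = 0) (n : ℕ) :
    ∃ R, MeasurableSet R ∧ μ.real R = 1 / 2 ∧
      ∀ A, MeasurableSet[countableFiltration X n] A → μ.real (A ∩ R) = μ.real A / 2 := by
  have hmeas : ∀ C ∈ countablePartition X n, MeasurableSet C := fun C hC =>
    measurableSet_countablePartition n hC
  choose! S hSC hSm hS using fun (C : Set X) (hC : MeasurableSet C) => aux_half μ h0 C hC
  have hfin := finite_countablePartition X n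
  let F := hfin.toFinset
  have hF : ∀ C, C ∈ F ↔ C ∈ countablePartition X n := fun C => hfin.mem_toFinset
  let R := ⋃ C ∈ F, S C
  have hRm : MeasurableSet R :=
    Finset.measurableSet_biUnion _ fun C hC => hSm C (hmeas C ((hF C).1 hC))
  have hdis : ∀ C ∈ F, ∀ D ∈ F, C ≠ D → Disjoint C D := fun C hC D hD h =>
    disjoint_countablePartition ((hF C).1 hC) ((hF D).1 hD) h
  have hRh : μ.real R = 1 / 2 := by
    have e1 : μ.real R = ∑ C ∈ F, μ.real (S C) :=
      measureReal_biUnion_finset (fun C hC D hD h => (hdis C hC D hD h).mono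
        (hSC C (hmeas C ((hF C).1 hC))) (hSC D (hmeas D ((hF D).1 hD))))
        (fun C hC => hSm C (hmeas C ((hF C).1 hC)))
    have e2 : μ.real (⋃ C ∈ F, C) = ∑ C ∈ F, μ.real C :=
      measureReal_biUnion_finset (fun C hC D hD h => hdis C hC D hD h)
        (fun C hC => hmeas C ((hF C).1 hC))
    have e3 : (⋃ C ∈ F, C) = univ := by
      rw [← sUnion_countablePartition X n, sUnion_eq_biUnion]
      simp only [hF]
    rw [e3, probReal_univ] at e2
    rw [e1, e2, Finset.sum_div]
    exact Finset.sum_congr rfl fun C hC => hS C (hmeas C ((hF C).1 hC))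
  refine ⟨R, hRm, hRh, fun A hA => ?_⟩
  have := aux_lim ((countableFiltration X).le n) μ (countablePartition X n) ?_ rfl
    (fun _ => R) (fun _ => hRm) (fun _ => hRh) ?_ A hA
  · exact tendsto_nhds_unique tendsto_const_nhds this
  · intro C hC D hD ⟨x, hx⟩
    by_cases h : C = D
    · subst h; simpa using hC
    · exact ((disjoint_countablePartition hC hD h).le_bot hx).elim
  · intro C hC
    have e : C ∩ R = S C := by
      ext x
      simp only [R, mem_inter_iff, mem_iUnion, exists_prop]
      constructor
      · rintro ⟨hx, D, hD, hxD⟩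
        by_cases h : C = D
        · rwa [h]
        · exact ((hdis C ((hF C).2 hC) D hD h).le_bot
            ⟨hx, hSC D (hmeas D ((hF D).1 hD)) hxD⟩).elim
      · exact fun hx => ⟨hSC C (hmeas C hC) hx, C, (hF C).2 hC, hx⟩
    rw [e, hS C (hmeas C hC)]
    exact tendsto_const_nhds

/-- **Lemma 21 (Hanneke).** For any nonatomic probability measure `π₀` on a Polish space,
there is a sequence `{R_k}` of Borel sets of `π₀`-measure `1/2` that asymptotically splits
every Borel set in half: `π₀(A ∩ R_k) → π₀(A)/2`. -/
theorem nonatomic_half_splitting (X : Type*)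
    [TopologicalSpace X] [PolishSpace X] [MeasurableSpace X] [BorelSpace X]
    (π₀ : Measure X) (hprob : IsProbabilityMeasure π₀)
    (hnonatomic : ∀ x : X, π₀ {x} = 0) :
    ∃ R : ℕ → Set X,
      (∀ k, MeasurableSet (R k)) ∧ (∀ k, π₀ (R k) = 1 / 2) ∧
        ∀ A : Set X, MeasurableSet A →
          Tendsto (fun k => π₀ (A ∩ R k)) atTop (𝓝 (π₀ A / 2)) := by
  choose R hRm hRh hR using aux_step π₀ hnonatomic
  refine ⟨R, hRm, fun k => ?_, fun A hA => ?_⟩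
  · have := hRh k
    rw [measureReal_def] at this
    rw [← ENNReal.ofReal_toReal (measure_ne_top π₀ (R k)), this,
      ENNReal.ofReal_div_of_pos two_pos]
    simp
  · have key := aux_lim le_rfl π₀
      (⋃ n, {t | MeasurableSet[ProbabilityTheory.countableFiltration X n] t}) ?_ ?_ R hRm hRh ?_ A hA
    · rw [← ENNReal.tendsto_toReal_iff (fun k => measure_ne_top _ _)
        (ENNReal.div_ne_top (measure_ne_top _ _) two_ne_zero), ENNReal.toReal_div]
      exact key
    · refine isPiSystem_iUnion_of_monotone _
        (fun n => @MeasurableSpace.isPiSystem_measurableSet _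
          (ProbabilityTheory.countableFiltration X n)) ?_
      intro i j hij t ht
      exact (ProbabilityTheory.countableFiltration X).mono hij _ ht
    · exact ((MeasurableSpace.generateFrom_iUnion_measurableSet
        (fun n => ProbabilityTheory.countableFiltration X n)).trans
        (ProbabilityTheory.iSup_countableFiltration X)).symm
    · intro B hB
      obtain ⟨n, hn⟩ := mem_iUnion.1 hB
      refine tendsto_const_nhds.congr' ?_
      filter_upwards [eventually_ge_atTop n] with k hk
      exact (hR k B ((ProbabilityTheory.countableFiltration X).mono hk _ hn)).symm
end

section
/- Fix a constant b ∈ (0,1). For each n ∈ ℕ let {z_{n,i}}_{i=1}^∞ be a sequence in [0,1], let {p_i}_{i=1}^∞ be a sequence in (0,1) with ∑_{i=1}^∞ p_i = 1, and define L_{n,i} := (1/n) ∑_{t=1}^n z_{t,i}, w_{1,i} := p_i, w_{n,i} := p_i · b^{(n-1) L_{n-1,i}} for n ≥ 2, v_{n,i} := w_{n,i} / ∑_{j=1}^∞ w_{n,j}, and z̄_n := ∑_{i=1}^∞ v_{n,i} z_{n,i}. Then for every n ∈ ℕ: (1/n) ∑_{t=1}^n z̄_t ≤ inf_{i ∈ ℕ}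 [ (ln(1/b)/(1-b)) L_{n,i} + (1/((1-b) n)) ln(1/p_i) ]. -/
open Filter Topology

/-- The (unnormalized) exponential weight of expert `i` entering round `n` (0-indexed):
`w_{n,i} = p_i · b^{∑_{t < n} z_{t,i}}`, so that `w_{0,i} = p_i`.  (In the 1-indexed
notation of the paper, this is `w_{n+1,i} = p_i · b^{n L_{n,i}}`.) -/
noncomputable def expWeight (b : ℝ) (p : ℕ → ℝ) (z : ℕ → ℕ → ℝ) (n i : ℕ) : ℝ :=
  p i * b ^ (∑ t ∈ Finset.range n, z t i)

/-- The normalized weight `v_{n,i} = w_{n,i} / ∑_j w_{n,j}`. -/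
noncomputable def normWeight (b : ℝ) (p : ℕ → ℝ) (z : ℕ → ℕ → ℝ) (n i : ℕ) : ℝ :=
  expWeight b p z n i / ∑' j : ℕ, expWeight b p z n j

/-- The weighted-average loss at round `n`: `z̄_n = ∑_i v_{n,i} z_{n,i}`. -/
noncomputable def avgLoss (b : ℝ) (p : ℕ → ℝ) (z : ℕ → ℕ → ℝ) (n : ℕ) : ℝ :=
  ∑' i : ℕ, normWeight b p z n i * z n i

theorem expWeight_pos_aux (b : ℝ) (hb : b ∈ Set.Ioo (0 : ℝ) 1)
    (z : ℕ → ℕ → ℝ) (p : ℕ → ℝ) (hp : ∀ i, p i ∈ Set.Ioo (0 : ℝ) 1) (n i : ℕ) :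
    0 < expWeight b p z n i :=
  mul_pos (hp i).1 (Real.rpow_pos_of_pos hb.1 _)

theorem expWeight_summable_aux (b : ℝ) (hb : b ∈ Set.Ioo (0 : ℝ) 1)
    (z : ℕ → ℕ → ℝ) (hz : ∀ n i, z n i ∈ Set.Icc (0 : ℝ) 1)
    (p : ℕ → ℝ) (hp : ∀ i, p i ∈ Set.Ioo (0 : ℝ) 1)
    (hs : Summable p) (n : ℕ) : Summable (expWeight b p z n) := by
  refine Summable.of_nonneg_of_le (fun i => (expWeight_pos_aux b hb z p hp n i).le)
    (fun i => ?_) hs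
  exact mul_le_of_le_one_right (hp i).1.le
    (Real.rpow_le_one hb.1.le hb.2.le (Finset.sum_nonneg fun t _ => (hz t i).1))

theorem expWeight_step_aux (b : ℝ) (hb : b ∈ Set.Ioo (0 : ℝ) 1)
    (z : ℕ → ℕ → ℝ) (hz : ∀ n i, z n i ∈ Set.Icc (0 : ℝ) 1)
    (p : ℕ → ℝ) (hp : ∀ i, p i ∈ Set.Ioo (0 : ℝ) 1)
    (hs : Summable p) (n : ℕ) :
    ∑' i, expWeight b p z (n + 1) i ≤
      (∑' i, expWeight b p z n i) * Real.exp (-((1 - b) * avgLoss b p z n)) := by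
  have hS := expWeight_summable_aux b hb z hz p hp hs
  have hpos := expWeight_pos_aux b hb z p hp
  have hW : 0 < ∑' i, expWeight b p z n i :=
    (hS n).tsum_pos (fun i => (hpos n i).le) 0 (hpos n 0)
  have hSz : Summable (fun i => expWeight b p z n i * z n i) :=
    Summable.of_nonneg_of_le (fun i => mul_nonneg (hpos n i).le (hz n i).1)
      (fun i => mul_le_of_le_one_right (hpos n i).le (hz n i).2) (hS n)
  have havg : avgLoss b p z n =
      (∑' i, expWeight b p z n i * z n i) / ∑' i, expWeight b p z n i := by
    unfold avgLoss normWeight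
    rw [← tsum_div_const]
    exact tsum_congr fun i => by ring
  have h1 : ∀ i, expWeight b p z (n + 1) i ≤
      expWeight b p z n i - (1 - b) * (expWeight b p z n i * z n i) := by
    intro i
    have hE : expWeight b p z (n + 1) i = expWeight b p z n i * b ^ (z n i) := by
      unfold expWeight
      rw [Finset.sum_range_succ, Real.rpow_add hb.1, mul_assoc]
    have hB : b ^ (z n i) ≤ 1 + z n i * (b - 1) := by
      have := rpow_one_add_le_one_add_mul_self (s := b - 1) (by linarith [hb.1])
        (hz n i).1 (hz n i).2
      simpa using this
    rw [hE]
    have := mul_le_mul_of_nonneg_left hB (hpos n i).le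
    linarith
  have h2 := (hS (n + 1)).tsum_le_tsum h1 ((hS n).sub (hSz.mul_left (1 - b)))
  rw [(hS n).tsum_sub (hSz.mul_left (1 - b)), tsum_mul_left] at h2
  have h3 : (∑' i, expWeight b p z n i * z n i) =
      avgLoss b p z n * ∑' i, expWeight b p z n i := by
    rw [havg]; field_simp
  have h4 := mul_le_mul_of_nonneg_left
    (Real.add_one_le_exp (-((1 - b) * avgLoss b p z n))) hW.le
  rw [h3] at h2
  linarith

theorem expWeight_total_aux (b : ℝ) (hb : b ∈ Set.Ioo (0 : ℝ) 1)
    (z : ℕ → ℕ → ℝ) (hz : ∀ n i, z n i ∈ Set.Icc (0 : ℝ) 1)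
    (p : ℕ → ℝ) (hp : ∀ i, p i ∈ Set.Ioo (0 : ℝ) 1)
    (hs : Summable p) (hpsum : ∑' i : ℕ, p i = 1) (n : ℕ) :
    ∑' i, expWeight b p z n i ≤
      Real.exp (-((1 - b) * ∑ t ∈ Finset.range n, avgLoss b p z t)) := by
  induction n with
  | zero => simp [expWeight, hpsum]
  | succ n ih =>
    refine (expWeight_step_aux b hb z hz p hp hs n).trans ?_
    refine (mul_le_mul_of_nonneg_right ih (Real.exp_pos _).le).trans_eq ?_
    rw [← Real.exp_add, Finset.sum_range_succ]
    congr 1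
    ring

/-- **Lemma 26 (Hanneke).** Regret bound for exponentially weighted averaging over
countably many experts: for every `n`,
`(1/n) ∑_{t=1}^n z̄_t ≤ inf_i [ (ln(1/b)/(1-b)) L_{n,i} + (1/((1-b)n)) ln(1/p_i) ]`,
where `L_{n,i} = (1/n) ∑_{t=1}^n z_{t,i}`. -/
theorem weighted_majority_regret (b : ℝ) (hb : b ∈ Set.Ioo (0 : ℝ) 1)
    (z : ℕ → ℕ → ℝ) (hz : ∀ n i, z n i ∈ Set.Icc (0 : ℝ) 1)
    (p : ℕ → ℝ) (hp : ∀ i, p i ∈ Set.Ioo (0 : ℝ) 1)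
    (hpsum : ∑' i : ℕ, p i = 1) (n : ℕ) :
    (∑ t ∈ Finset.range n, avgLoss b p z t) / (n : ℝ) ≤
      ⨅ i : ℕ,
        (Real.log (1 / b) / (1 - b)) * ((∑ t ∈ Finset.range n, z t i) / (n : ℝ)) +
          (1 / ((1 - b) * (n : ℝ))) * Real.log (1 / p i) := by
  have hs : Summable p := by
    by_contra h
    rw [tsum_eq_zero_of_not_summable h] at hpsum
    exact zero_ne_one hpsum
  refine le_ciInf fun i => ?_
  rcases Nat.eq_zero_or_pos n with rfl | hn
  · simp
  have hn' : (0 : ℝ) < n := by exact_mod_cast hn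
  have hb' : 0 < 1 - b := by linarith [hb.2]
  have h1 : expWeight b p z n i ≤ _ :=
    ((expWeight_summable_aux b hb z hz p hp hs n).le_tsum i
      (fun j _ => (expWeight_pos_aux b hb z p hp n j).le)).trans
      (expWeight_total_aux b hb z hz p hp hs hpsum n)
  have h2 := Real.log_le_log (expWeight_pos_aux b hb z p hp n i) h1
  rw [Real.log_exp, expWeight, Real.log_mul (hp i).1.ne' (Real.rpow_pos_of_pos hb.1 _).ne',
    Real.log_rpow hb.1] at h2
  rw [one_div b, one_div (p i), Real.log_inv, Real.log_inv]
  have h3 : -Real.log b / (1 - b) * ((∑ t ∈ Finset.range n, z t i) / (n : ℝ)) +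
      1 / ((1 - b) * (n : ℝ)) * -Real.log (p i) =
      ((-(Real.log (p i) + (∑ t ∈ Finset.range n, z t i) * Real.log b)) / (1 - b)) / n := by
    field_simp
    ring
  rw [h3]
  refine div_le_div_of_nonneg_right ?_ hn'.le
  rw [le_div_iff₀ hb']
  linarith
end

section
/- Every process that admits strong universal online learning satisfies Condition 2; that is, SUOL ⊆ C2. -/
open MeasureTheory Filter Topology

/-- Condition 2: for every sequence `{A_k}` of pairwise disjoint measurable sets, the number
of indices `k` with `X_{1:T} ∩ A_k ≠ ∅` is `o(T)` almost surely. -/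
def Condition2 {X : Type*} [MeasurableSpace X] (μ : Measure (ℕ → X)) : Prop :=
  ∀ A : ℕ → Set X, (∀ k, MeasurableSet (A k)) →
    (Pairwise fun k l => Disjoint (A k) (A l)) →
    ∀ᵐ x ∂μ, Tendsto
      (fun T : ℕ => (({k : ℕ | ∃ t ∈ Finset.range T, x t ∈ A k}.ncard : ℝ)) / (T : ℝ))
      atTop (𝓝 0)

/-- An online learning rule: a sequence of measurable functions `f_n : X^n × Y^n × X → Y`. -/
def IsOnlineRule {X Y : Type*} [MeasurableSpace X] [MeasurableSpace Y]
    (f : ∀ n : ℕ, (Fin n → X) → (Fin n → Y) → X → Y) : Prop :=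
  ∀ n : ℕ, Measurable fun p : (Fin n → X) × (Fin n → Y) × X => f n p.1 p.2.1 p.2.2

/-- The average loss `L̂_𝕏(f_·, f*; n)` of an online learning rule along the path `x`
(0-indexed): `(1/n) ∑_{t=0}^{n-1} ℓ(f_t(X_{1:t}, f*(X_{1:t}), X_{t+1}), f*(X_{t+1}))`. -/
noncomputable def onlLoss {X Y : Type*} [PseudoMetricSpace Y]
    (f : ∀ n : ℕ, (Fin n → X) → (Fin n → Y) → X → Y)
    (fstar : X → Y) (n : ℕ) (x : ℕ → X) : ℝ :=
  (∑ t ∈ Finset.range n,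
      dist (f t (fun i => x i.1) (fun i => fstar (x i.1)) (x t)) (fstar (x t))) / (n : ℝ)

/-- Strong universal consistency of an online learning rule under the process with law `μ`. -/
def StronglyConsistentOnl {X Y : Type*} [MeasurableSpace X] [MeasurableSpace Y]
    [PseudoMetricSpace Y] (μ : Measure (ℕ → X))
    (f : ∀ n : ℕ, (Fin n → X) → (Fin n → Y) → X → Y) : Prop :=
  ∀ fstar : X → Y, Measurable fstar →
    ∀ᵐ x ∂μ, Tendsto (fun n => onlLoss f fstar n x) atTop (𝓝 0)

/-- `SUOL`: the process with law `μ` admits strong universal online learning. -/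
def SUOL {X : Type*} (Y : Type*) [MeasurableSpace X] [MeasurableSpace Y] [PseudoMetricSpace Y]
    (μ : Measure (ℕ → X)) : Prop :=
  ∃ f : ∀ n : ℕ, (Fin n → X) → (Fin n → Y) → X → Y,
    IsOnlineRule f ∧ StronglyConsistentOnl μ f

lemma exists_coin : ∃ ν : Measure (ℕ → Bool), IsProbabilityMeasure ν ∧
    ∀ k : ℕ, MeasurePreserving (fun σ : ℕ → Bool => Function.update σ k (!(σ k))) ν ν := by
  classical
  let c : Measure Bool := (2⁻¹ : ENNReal) • (Measure.dirac true + Measure.dirac false)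
  have hc : IsProbabilityMeasure c := by
    constructor
    simp only [c, Measure.smul_apply, Measure.add_apply, measure_univ, smul_eq_mul]
    rw [one_add_one_eq_two]
    exact ENNReal.inv_mul_cancel (by simp) (by simp)
  have hm : Measurable (fun b : Bool => !b) := measurable_of_countable _
  have hnot : c.map (fun b : Bool => !b) = c := by
    simp only [c, Measure.map_smul, Measure.map_add _ _ hm, Measure.map_dirac' hm,
      Bool.not_true, Bool.not_false]
    rw [add_comm]
  refine ⟨Measure.infinitePi (fun _ : ℕ => c), inferInstance, fun k => ?_⟩
  let g : ℕ → Bool → Bool := fun i b => if i = k then !b else b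
  have hg : ∀ i, Measurable (g i) := fun i => measurable_of_countable _
  have he : (fun σ : ℕ → Bool => Function.update σ k (!(σ k))) = fun σ i => g i (σ i) := by
    funext σ i
    by_cases h : i = k
    · subst h; simp [g]
    · simp [g, h]
  rw [he]
  refine ⟨measurable_pi_lambda _ fun i => (hg i).comp (measurable_pi_apply i), ?_⟩
  rw [Measure.infinitePi_map_pi (fun _ : ℕ => c) hg]
  congr 1
  funext i
  by_cases h : i = k
  · simp only [g, h, if_true]; exact hnot
  · simp only [g, h, if_false]; exact Measure.map_id

open Classical in
/-- The random target function. -/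
noncomputable def tgt {X Y : Type*} (A : ℕ → Set X) (y₀ y₁ : Y) (σ : ℕ → Bool) (x : X) : Y :=
  if ∃ k, x ∈ A k ∧ σ k = true then y₁ else y₀

lemma tgt_measurable {X Y : Type*} [MeasurableSpace X] [MeasurableSpace Y] (A : ℕ → Set X)
    (hA : ∀ k, MeasurableSet (A k)) (y₀ y₁ : Y) :
    Measurable fun p : (ℕ → Bool) × X => tgt A y₀ y₁ p.1 p.2 := by
  classical
  unfold tgt
  refine Measurable.ite ?_ measurable_const measurable_const
  have : {p : (ℕ → Bool) × X | ∃ k, p.2 ∈ A k ∧ p.1 k = true} =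
      ⋃ k, (Prod.snd ⁻¹' A k ∩ (fun p : (ℕ → Bool) × X => p.1 k) ⁻¹' {true}) := by
    ext p; simp
  rw [this]
  refine MeasurableSet.iUnion fun k => ((hA k).preimage measurable_snd).inter ?_
  exact ((measurable_pi_apply k).comp measurable_fst) (MeasurableSet.singleton _)

lemma tgt_mem {X Y : Type*} (A : ℕ → Set X)
    (hd : Pairwise fun k l => Disjoint (A k) (A l)) (y₀ y₁ : Y) (σ : ℕ → Bool) (x : X) (k : ℕ)
    (hx : x ∈ A k) : tgt A y₀ y₁ σ x = if σ k = true then y₁ else y₀ := by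
  classical
  unfold tgt
  have : (∃ j, x ∈ A j ∧ σ j = true) ↔ σ k = true := by
    constructor
    · rintro ⟨j, hj, h⟩
      by_cases e : j = k
      · exact e ▸ h
      · exact absurd hx (Set.disjoint_left.1 (hd e) hj)
    · exact fun h => ⟨k, hx, h⟩
  simp only [this]

lemma tgt_not_mem {X Y : Type*} (A : ℕ → Set X) (y₀ y₁ : Y) (σ : ℕ → Bool) (x : X) (k : ℕ)
    (b : Bool) (hx : x ∉ A k) :
    tgt A y₀ y₁ (Function.update σ k b) x = tgt A y₀ y₁ σ x := by
  classical
  unfold tgt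
  have : (∃ j, x ∈ A j ∧ Function.update σ k b j = true) ↔ ∃ j, x ∈ A j ∧ σ j = true := by
    refine exists_congr fun j => and_congr_right fun hj => ?_
    have : j ≠ k := fun e => hx (e ▸ hj)
    simp [this]
  simp only [this]

/-- The instantaneous loss at time `t`. -/
noncomputable def stepLoss {X Y : Type*} [PseudoMetricSpace Y]
    (f : ∀ n : ℕ, (Fin n → X) → (Fin n → Y) → X → Y) (A : ℕ → Set X) (y₀ y₁ : Y)
    (t : ℕ) (x : ℕ → X) (σ : ℕ → Bool) : ℝ :=
  dist (f t (fun i => x i.1) (fun i => tgt A y₀ y₁ σ (x i.1)) (x t)) (tgt A y₀ y₁ σ (x t))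

lemma stepLoss_measurable {X Y : Type*} [MeasurableSpace X] [MetricSpace Y]
    [TopologicalSpace.SeparableSpace Y] [MeasurableSpace Y] [BorelSpace Y]
    (f : ∀ n : ℕ, (Fin n → X) → (Fin n → Y) → X → Y) (hf : IsOnlineRule f)
    (A : ℕ → Set X) (hA : ∀ k, MeasurableSet (A k)) (y₀ y₁ : Y) (t : ℕ) :
    Measurable fun p : (ℕ → X) × (ℕ → Bool) => stepLoss f A y₀ y₁ t p.1 p.2 := by
  have : SecondCountableTopology Y := UniformSpace.secondCountable_of_separable Y
  have hx : ∀ i : ℕ, Measurable fun p : (ℕ → X) × (ℕ → Bool) => p.1 i :=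
    fun i => (measurable_pi_apply i).comp measurable_fst
  have ht : ∀ i : ℕ, Measurable fun p : (ℕ → X) × (ℕ → Bool) => tgt A y₀ y₁ p.2 (p.1 i) :=
    fun i => (tgt_measurable A hA y₀ y₁).comp (measurable_snd.prodMk (hx i))
  unfold stepLoss
  refine Measurable.dist ?_ (ht t)
  exact (hf t).comp ((measurable_pi_lambda _ fun i : Fin t => hx i.1).prodMk
    ((measurable_pi_lambda _ fun i : Fin t => ht i.1).prodMk (hx t)))

lemma stepLoss_integral {X Y : Type*} [MetricSpace Y]
    (f : ∀ n : ℕ, (Fin n → X) → (Fin n → Y) → X → Y)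
    (A : ℕ → Set X) (hd : Pairwise fun k l => Disjoint (A k) (A l))
    (y₀ y₁ : Y) (t : ℕ) (x : ℕ → X)
    (ν : Measure (ℕ → Bool)) [IsProbabilityMeasure ν] (k : ℕ)
    (hν : MeasurePreserving (fun σ : ℕ → Bool => Function.update σ k (!(σ k))) ν ν)
    (hi : Integrable (stepLoss f A y₀ y₁ t x) ν)
    (hk : x t ∈ A k) (hnew : ∀ s < t, x s ∉ A k) :
    dist y₀ y₁ / 2 ≤ ∫ σ, stepLoss f A y₀ y₁ t x σ ∂ν := by
  have hi2 : Integrable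
      (fun σ => stepLoss f A y₀ y₁ t x (Function.update σ k (!(σ k)))) ν :=
    hν.integrable_comp_of_integrable hi
  have h2 : ∫ σ, stepLoss f A y₀ y₁ t x (Function.update σ k (!(σ k))) ∂ν =
      ∫ σ, stepLoss f A y₀ y₁ t x σ ∂ν := by
    have := integral_map (μ := ν) hν.measurable.aemeasurable
      (f := stepLoss f A y₀ y₁ t x) (by rw [hν.map_eq]; exact hi.1)
    rw [hν.map_eq] at this
    exact this.symm
  have h3 : dist y₀ y₁ ≤ ∫ σ, (stepLoss f A y₀ y₁ t x σ +
      stepLoss f A y₀ y₁ t x (Function.update σ k (!(σ k)))) ∂ν := by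
    have : dist y₀ y₁ = ∫ _ : ℕ → Bool, dist y₀ y₁ ∂ν := by simp
    rw [this]
    refine integral_mono (integrable_const _) (hi.add hi2) fun σ => ?_
    have hpast : (fun i : Fin t => tgt A y₀ y₁ (Function.update σ k (!(σ k))) (x i.1)) =
        fun i : Fin t => tgt A y₀ y₁ σ (x i.1) := by
      funext i
      exact tgt_not_mem A y₀ y₁ σ _ k _ (hnew _ i.2)
    simp only [stepLoss, hpast, tgt_mem A hd y₀ y₁ _ _ k hk, Function.update_self]
    generalize f t _ _ _ = z
    cases σ k
    · simpa using dist_triangle_left y₀ y₁ z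
    · simpa [add_comm] using dist_triangle_left y₀ y₁ z
  rw [integral_add hi hi2, h2] at h3
  linarith

lemma count_le {X : Type*} (A : ℕ → Set X) (hd : Pairwise fun k l => Disjoint (A k) (A l))
    (x : ℕ → X) (d : ℝ) (hd0 : 0 ≤ d) (E : ℕ → ℝ) (hE0 : ∀ t, 0 ≤ E t)
    (hE : ∀ t k, x t ∈ A k → (∀ s < t, x s ∉ A k) → d ≤ E t) (T : ℕ) :
    d * (({k : ℕ | ∃ t ∈ Finset.range T, x t ∈ A k}.ncard : ℝ)) ≤ ∑ t ∈ Finset.range T, E t := by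
  induction T with
  | zero => simp
  | succ T ih =>
    rw [Finset.sum_range_succ]
    by_cases h : ∃ k, x T ∈ A k ∧ ∀ s < T, x s ∉ A k
    · obtain ⟨k, hk, hn⟩ := h
      have hs : {k : ℕ | ∃ t ∈ Finset.range (T + 1), x t ∈ A k} =
          insert k {k : ℕ | ∃ t ∈ Finset.range T, x t ∈ A k} := by
        ext j
        simp only [Set.mem_ofPred_eq, Set.mem_insert_iff, Finset.mem_range]
        constructor
        · rintro ⟨t, ht, hj⟩
          rcases Nat.lt_succ_iff_lt_or_eq.1 ht with h | rfl
          · exact Or.inr ⟨t, h, hj⟩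
          · left
            by_contra e
            exact Set.disjoint_left.1 (hd e) hj hk
        · rintro (rfl | ⟨t, ht, hj⟩)
          · exact ⟨T, by omega, hk⟩
          · exact ⟨t, by omega, hj⟩
      rw [hs]
      have h1 : ((insert k {k : ℕ | ∃ t ∈ Finset.range T, x t ∈ A k}).ncard : ℝ) ≤
          ({k : ℕ | ∃ t ∈ Finset.range T, x t ∈ A k}.ncard : ℝ) + 1 := by
        exact_mod_cast Set.ncard_insert_le _ _
      have h2 := hE T k hk hn
      have h3 := mul_le_mul_of_nonneg_left h1 hd0
      linarith
    · push Not at h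
      have hs : {k : ℕ | ∃ t ∈ Finset.range (T + 1), x t ∈ A k} =
          {k : ℕ | ∃ t ∈ Finset.range T, x t ∈ A k} := by
        ext j
        simp only [Set.mem_ofPred_eq, Finset.mem_range]
        constructor
        · rintro ⟨t, ht, hj⟩
          rcases Nat.lt_succ_iff_lt_or_eq.1 ht with h' | rfl
          · exact ⟨t, h', hj⟩
          · exact h j hj
        · rintro ⟨t, ht, hj⟩
          exact ⟨t, by omega, hj⟩
      rw [hs]
      have := hE0 T
      linarith

/-- **Theorem 31 (Hanneke).** `SUOL ⊆ C2`: every process admitting strong universal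
online learning satisfies Condition 2. -/
theorem SUOL_subset_condition2 (X Y : Type*)
    [TopologicalSpace X] [TopologicalSpace.MetrizableSpace X]
    [TopologicalSpace.SeparableSpace X] [Nonempty X] [MeasurableSpace X] [BorelSpace X]
    [MetricSpace Y] [TopologicalSpace.SeparableSpace Y] [Nonempty Y]
    [MeasurableSpace Y] [BorelSpace Y]
    (hbdd : ∃ C : ℝ, ∀ y₁ y₂ : Y, dist y₁ y₂ ≤ C)
    (hnontriv : ∃ y₁ y₂ : Y, 0 < dist y₁ y₂) :
    ∀ μ : Measure (ℕ → X), IsProbabilityMeasure μ → SUOL Y μ → Condition2 μ := by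
  intro μ hμ ⟨f, hf, hcons⟩ A hA hd
  obtain ⟨C, hC⟩ := hbdd
  obtain ⟨y₀, y₁, hy⟩ := hnontriv
  obtain ⟨ν, hν, hflip⟩ := exists_coin
  have hmeas := stepLoss_measurable f hf A hA y₀ y₁
  have hloss : ∀ n x σ, onlLoss f (tgt A y₀ y₁ σ) n x =
      (∑ t ∈ Finset.range n, stepLoss f A y₀ y₁ t x σ) / (n : ℝ) := fun n x σ => rfl
  have hset : MeasurableSet {p : (ℕ → X) × (ℕ → Bool) |
      Tendsto (fun n => onlLoss f (tgt A y₀ y₁ p.2) n p.1) atTop (𝓝 0)} := by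
    simp only [hloss]
    exact measurableSet_tendsto_fun
      (fun n => (Finset.measurable_sum _ fun t _ => hmeas t).div_const _) measurable_const
  have hae : ∀ᵐ x ∂μ, ∀ᵐ σ ∂ν,
      Tendsto (fun n => onlLoss f (tgt A y₀ y₁ σ) n x) atTop (𝓝 0) := by
    rw [Measure.ae_ae_comm hset]
    exact Eventually.of_forall fun σ => hcons _ ((tgt_measurable A hA y₀ y₁).comp
      (measurable_const.prodMk measurable_id))
  filter_upwards [hae] with x hx
  have hs0 : ∀ t σ, 0 ≤ stepLoss f A y₀ y₁ t x σ := fun t σ => dist_nonneg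
  have hC0 : 0 ≤ C := dist_nonneg.trans (hC y₀ y₁)
  have hm : ∀ t, Measurable (stepLoss f A y₀ y₁ t x) := fun t =>
    (hmeas t).comp (measurable_const.prodMk measurable_id)
  have hint : ∀ t, Integrable (stepLoss f A y₀ y₁ t x) ν := fun t =>
    Integrable.of_bound (hm t).aestronglyMeasurable C (Eventually.of_forall fun σ => by
      rw [Real.norm_of_nonneg (hs0 t σ)]; exact hC _ _)
  have hlim : Tendsto (fun n => ∫ σ, onlLoss f (tgt A y₀ y₁ σ) n x ∂ν) atTop (𝓝 0) := by
    have := tendsto_integral_of_dominated_convergence (μ := ν)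
      (F := fun n σ => onlLoss f (tgt A y₀ y₁ σ) n x) (f := fun _ => (0 : ℝ)) (fun _ => C)
      (fun n => by
        simp only [hloss]
        exact ((Finset.measurable_sum _ fun t _ => hm t).div_const _).aestronglyMeasurable)
      (integrable_const _)
      (fun n => Eventually.of_forall fun σ => by
        rw [hloss, Real.norm_of_nonneg
          (div_nonneg (Finset.sum_nonneg fun t _ => hs0 t σ) (Nat.cast_nonneg _))]
        refine div_le_of_le_mul₀ (Nat.cast_nonneg _) hC0 ?_
        calc _ ≤ ∑ t ∈ Finset.range n, C := Finset.sum_le_sum fun _ _ => hC _ _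
          _ = C * n := by simp [mul_comm])
      hx
    simpa using this
  have hd2 : 0 < dist y₀ y₁ / 2 := by linarith
  have hlim2 := hlim.div_const (dist y₀ y₁ / 2)
  rw [zero_div] at hlim2
  refine squeeze_zero (fun T => div_nonneg (Nat.cast_nonneg _) (Nat.cast_nonneg _))
    (fun T => ?_) hlim2
  have hcount := count_le A hd x (dist y₀ y₁ / 2) hd2.le
    (fun t => ∫ σ, stepLoss f A y₀ y₁ t x σ ∂ν)
    (fun t => integral_nonneg fun σ => dist_nonneg)
    (fun t k hk hn => stepLoss_integral f A hd y₀ y₁ t x ν k (hflip k) (hint t) hk hn) T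
  simp only [hloss]
  rw [integral_div, integral_finsetSum _ (fun t _ => hint t), le_div_iff₀ hd2, div_mul_eq_mul_div,
    mul_comm]
  exact div_le_div_of_nonneg_right hcount (Nat.cast_nonneg _)
end

section
/- If X is countable, then a process admits strong universal online learning if and only if it satisfies Condition 2 (i.e., SUOL = C2), and moreover there exists an optimistically universal online learning rule. -/
open MeasureTheory Filter Topology

open Classical in
lemma suol_card_image_range_succ (z : ℕ → ℕ) (T : ℕ) :
    (((Finset.range T).image z).card : ℝ) =
      ∑ t ∈ Finset.range T, (if ∀ s < t, z s ≠ z t then (1 : ℝ) else 0) := by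
  induction T with
  | zero => simp
  | succ T ih =>
    rw [Finset.sum_range_succ, ← ih, Finset.range_add_one, Finset.image_insert]
    split_ifs with h
    · rw [Finset.card_insert_of_notMem]
      · push_cast; ring
      · simpa using h
    · rw [Finset.insert_eq_of_mem]
      · simp
      · push Not at h
        simpa using h

lemma suol_exists_coin : ∃ ν : Measure (ℕ → Bool), IsProbabilityMeasure ν ∧
    ∀ k : ℕ, MeasurePreserving (fun (ε : ℕ → Bool) i => if i = k then !(ε i) else ε i) ν ν := by
  let β : Measure Bool := (2⁻¹ : ENNReal) • Measure.count
  have hβ : IsProbabilityMeasure β := ⟨by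
    have : (Measure.count (Set.univ : Set Bool)) = 2 := by
      rw [Measure.count_apply MeasurableSet.univ, Set.encard_univ,
        ENat.card_eq_coe_fintype_card]
      simp
    rw [Measure.smul_apply, this, smul_eq_mul]
    exact ENNReal.inv_mul_cancel (by norm_num) (by norm_num)⟩
  have hnot : β.map (fun b => !b) = β := by
    simp only [β, Measure.map_smul]
    congr 1
    ext s hs
    rw [Measure.map_apply (measurable_of_countable _) hs,
      Measure.count_apply (measurable_of_countable _ hs), Measure.count_apply hs]
    congr 1
    have hinv : Function.Involutive (fun b : Bool => !b) := Bool.not_not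
    rw [← hinv.injective.encard_image, Set.image_preimage_eq _ hinv.surjective]
  refine ⟨Measure.infinitePi (fun _ => β), inferInstance, fun k => ⟨?_, ?_⟩⟩
  · refine measurable_pi_lambda _ fun i => ?_
    split_ifs
    · exact (measurable_of_countable (fun b : Bool => !b)).comp (measurable_pi_apply i)
    · exact measurable_pi_apply i
  · have := Measure.infinitePi_map_pi (fun _ : ℕ => β)
      (f := fun i b => if i = k then !b else b) (fun i => measurable_of_countable _)
    rw [this]
    congr 1
    ext1 i
    by_cases h : i = k
    · simp [h, hnot]
    · simp [h]

open Classical in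
lemma suol_key {X Y : Type*} [Countable X] [MeasurableSpace X] [DiscreteMeasurableSpace X]
    [MetricSpace Y] [TopologicalSpace.SeparableSpace Y] [MeasurableSpace Y] [BorelSpace Y]
    {C : ℝ} (hC : ∀ y₁ y₂ : Y, dist y₁ y₂ ≤ C) {y₁ y₂ : Y} (hy : 0 < dist y₁ y₂)
    (μ : Measure (ℕ → X)) [IsProbabilityMeasure μ] (h : SUOL Y μ) (κ : X → ℕ) :
    ∀ᵐ x ∂μ, Tendsto
      (fun T : ℕ => (((Finset.range T).image (fun t => κ (x t))).card : ℝ) / T) atTop (𝓝 0) := by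
  have := UniformSpace.secondCountable_of_separable Y
  obtain ⟨f, hf, hcons⟩ := h
  obtain ⟨ν, hν, hflip⟩ := suol_exists_coin
  let F : (ℕ → Bool) → X → Y := fun ε x => if ε (κ x) then y₁ else y₂
  have hFm : Measurable (fun p : X × (ℕ → Bool) => F p.2 p.1) := by
    refine measurable_from_prod_countable_right fun x => ?_
    exact (measurable_of_countable (fun b : Bool => if b then y₁ else y₂)).comp
      (measurable_pi_apply (κ x))
  let g : ℕ → (ℕ → X) × (ℕ → Bool) → ℝ := fun t p =>
    dist (f t (fun i => p.1 i.1) (fun i => F p.2 (p.1 i.1)) (p.1 t)) (F p.2 (p.1 t))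
  have hgm : ∀ t, Measurable (g t) := by
    intro t
    have h1 : ∀ i : ℕ, Measurable (fun p : (ℕ → X) × (ℕ → Bool) => F p.2 (p.1 i)) := fun i =>
      hFm.comp (g := fun p : X × (ℕ → Bool) => F p.2 p.1)
        (f := fun p : (ℕ → X) × (ℕ → Bool) => (p.1 i, p.2))
        (((measurable_pi_apply i).comp measurable_fst).prodMk measurable_snd)
    refine Measurable.dist ?_ (h1 t)
    refine (hf t).comp (Measurable.prodMk ?_ (Measurable.prodMk ?_ ?_))
    · exact measurable_pi_lambda _ fun i => (measurable_pi_apply i.1).comp measurable_fst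
    · exact measurable_pi_lambda _ fun i => h1 i
    · exact (measurable_pi_apply t).comp measurable_fst
  have hLm : ∀ n, Measurable (fun p : (ℕ → X) × (ℕ → Bool) => onlLoss f (F p.2) n p.1) := by
    intro n
    exact (Finset.measurable_sum _ fun t _ => hgm t).div_const _
  have h1 : ∀ᵐ ε ∂ν, ∀ᵐ x ∂μ, Tendsto (fun n => onlLoss f (F ε) n x) atTop (𝓝 0) :=
    Eventually.of_forall fun ε => hcons (F ε) (measurable_of_countable _)
  have h2 : ∀ᵐ x ∂μ, ∀ᵐ ε ∂ν, Tendsto (fun n => onlLoss f (F ε) n x) atTop (𝓝 0) := by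
    refine (Measure.ae_ae_comm ?_).1 h1
    exact measurableSet_tendsto (𝓝 0) (fun n => (hLm n).comp measurable_swap)
  filter_upwards [h2] with x hx
  have hC0 : 0 ≤ C := dist_nonneg.trans (hC y₁ y₂)
  have hgx : ∀ t, Measurable (fun ε => g t (x, ε)) := fun t =>
    (hgm t).comp measurable_prodMk_left
  have hgi : ∀ t, Integrable (fun ε => g t (x, ε)) ν := fun t =>
    Integrable.of_bound (hgx t).aestronglyMeasurable C
      (Eventually.of_forall fun ε => by
        rw [Real.norm_of_nonneg dist_nonneg]; exact hC _ _)
  have hlim : Tendsto (fun n => ∫ ε, onlLoss f (F ε) n x ∂ν) atTop (𝓝 0) := by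
    have := tendsto_integral_of_dominated_convergence (μ := ν)
      (F := fun n ε => onlLoss f (F ε) n x) (f := fun _ => (0 : ℝ)) (fun _ => C)
      (fun n => ((hLm n).comp measurable_prodMk_left).aestronglyMeasurable)
      (integrable_const _) (fun n => Eventually.of_forall fun ε => ?_) hx
    · simpa using this
    · have h0 : 0 ≤ onlLoss f (F ε) n x :=
        div_nonneg (Finset.sum_nonneg fun _ _ => dist_nonneg) (Nat.cast_nonneg n)
      rw [Real.norm_of_nonneg h0]
      refine div_le_of_le_mul₀ (Nat.cast_nonneg n) hC0 ?_
      refine (Finset.sum_le_sum fun t _ => hC _ _).trans ?_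
      simp [mul_comm]
  have hnew : ∀ t, (if ∀ s < t, κ (x s) ≠ κ (x t) then (1 : ℝ) else 0) * (dist y₁ y₂ / 2) ≤
      ∫ ε, g t (x, ε) ∂ν := by
    intro t
    split_ifs with ht
    · have hmp := hflip (κ (x t))
      set φ : (ℕ → Bool) → (ℕ → Bool) := fun ε i => if i = κ (x t) then !(ε i) else ε i with hφ
      have hint : ∫ ε, g t (x, φ ε) ∂ν = ∫ ε, g t (x, ε) ∂ν := by
        have := integral_map (μ := ν) hmp.measurable.aemeasurable
          (f := fun ε => g t (x, ε)) (hgx t).aestronglyMeasurable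
        rw [hmp.map_eq] at this
        exact this.symm
      have hgi' : Integrable (fun ε => g t (x, φ ε)) ν :=
        Integrable.of_bound ((hgx t).comp hmp.measurable).aestronglyMeasurable C
          (Eventually.of_forall fun ε => by
            rw [Real.norm_of_nonneg dist_nonneg]; exact hC _ _)
      have hsum : dist y₁ y₂ ≤ ∫ ε, (g t (x, ε) + g t (x, φ ε)) ∂ν := by
        have : ∫ ε, dist y₁ y₂ ∂ν ≤ ∫ ε, (g t (x, ε) + g t (x, φ ε)) ∂ν := by
          refine integral_mono (integrable_const _) ((hgi t).add hgi') fun ε => ?_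
          have e1 : (fun i : Fin t => F (φ ε) (x i.1)) = fun i : Fin t => F ε (x i.1) := by
            funext i
            simp [F, φ, ht i.1 i.2]
          simp only [g, e1]
          set p := f t (fun i => x i.1) (fun i => F ε (x i.1)) (x t)
          have hd1 := dist_triangle_left y₁ y₂ p
          cases hb : ε (κ (x t))
          · simp only [F, φ, hb]; simpa [add_comm] using hd1
          · simp only [F, φ, hb]; simpa using hd1
        simpa using this
      rw [integral_add (hgi t) hgi', hint] at hsum
      linarith
    · simp only [zero_mul]
      exact integral_nonneg fun ε => dist_nonneg
  have hlow : ∀ n : ℕ, (((Finset.range n).image (fun t => κ (x t))).card : ℝ) / n ≤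
      (2 / dist y₁ y₂) * ∫ ε, onlLoss f (F ε) n x ∂ν := by
    intro n
    have e : ∫ ε, onlLoss f (F ε) n x ∂ν = (∑ t ∈ Finset.range n, ∫ ε, g t (x, ε) ∂ν) / n := by
      rw [← integral_finsetSum _ fun t _ => hgi t, ← integral_div]
      rfl
    have hs := Finset.sum_le_sum fun t (_ : t ∈ Finset.range n) => hnew t
    rw [← Finset.sum_mul, ← suol_card_image_range_succ (fun t => κ (x t)) n] at hs
    rw [e, ← mul_div_assoc]
    refine div_le_div_of_nonneg_right ?_ (Nat.cast_nonneg n)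
    calc _ = (2 / dist y₁ y₂) * ((((Finset.range n).image (fun t => κ (x t))).card : ℝ)
              * (dist y₁ y₂ / 2)) := by field_simp
      _ ≤ _ := mul_le_mul_of_nonneg_left hs (by positivity)
  refine squeeze_zero (fun n => by positivity) hlow ?_
  simpa using hlim.const_mul (2 / dist y₁ y₂)

open Classical in
noncomputable def suolMem {X Y : Type*} (y₀ : Y) (n : ℕ) (xs : Fin n → X) (ys : Fin n → Y)
    (x : X) : Y :=
  if h : ∃ i, xs i = x then ys h.choose else y₀

lemma suolMem_rule {X Y : Type*} [Countable X] [MeasurableSpace X] [DiscreteMeasurableSpace X]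
    [MeasurableSpace Y] (y₀ : Y) : IsOnlineRule (suolMem (X := X) y₀) := by
  intro n
  refine measurable_from_prod_countable_right fun xs => ?_
  refine measurable_from_prod_countable_left fun x => ?_
  by_cases h : ∃ i, xs i = x
  · simp only [suolMem, h, dite_true]
    exact measurable_pi_apply h.choose
  · simp only [suolMem, h, dite_false]
    exact measurable_const

open Classical in
lemma suolMem_cons {X Y : Type*} [Countable X] [MeasurableSpace X] [DiscreteMeasurableSpace X]
    [MetricSpace Y] [MeasurableSpace Y] (y₀ : Y)
    {C : ℝ} (hC : ∀ y₁ y₂ : Y, dist y₁ y₂ ≤ C)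
    (μ : Measure (ℕ → X)) (h : Condition2 μ) : StronglyConsistentOnl μ (suolMem (X := X) y₀) := by
  intro F _
  obtain ⟨e, he⟩ := exists_injective_nat X
  have h2 := h (fun k => {x | e x = k}) (fun k => MeasurableSet.of_discrete) (by
    intro k l hkl
    rw [Set.disjoint_left]
    intro x hx hx'
    exact hkl (hx.symm.trans hx'))
  filter_upwards [h2] with x hx
  have hset : ∀ T : ℕ, ({k : ℕ | ∃ t ∈ Finset.range T, x t ∈ {x | e x = k}}.ncard : ℝ) =
      (((Finset.range T).image (fun t => e (x t))).card : ℝ) := by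
    intro T
    rw [← Set.ncard_coe_finset]
    congr 2
    ext k
    simp
  have hx : Tendsto (fun T : ℕ => (((Finset.range T).image (fun t => e (x t))).card : ℝ) / T)
      atTop (𝓝 0) := hx.congr fun T => by rw [← hset T]; rfl
  have hx' := hx.const_mul C
  rw [mul_zero] at hx'
  refine squeeze_zero (fun n => div_nonneg (Finset.sum_nonneg fun _ _ => dist_nonneg)
    (Nat.cast_nonneg n)) (fun n => ?_) hx'
  rw [← mul_div_assoc, suol_card_image_range_succ]
  refine div_le_div_of_nonneg_right ?_ (Nat.cast_nonneg n)
  rw [Finset.mul_sum]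
  refine Finset.sum_le_sum fun t _ => ?_
  split_ifs with ht
  · simpa using hC _ _
  · push Not at ht
    obtain ⟨s, hs, hst⟩ := ht
    have hex : ∃ i : Fin t, x i.1 = x t := ⟨⟨s, hs⟩, he hst⟩
    simp only [suolMem, hex, dite_true, hex.choose_spec]
    simp

lemma suol_to_c2 {X Y : Type*} [Countable X] [MeasurableSpace X] [DiscreteMeasurableSpace X]
    [MetricSpace Y] [TopologicalSpace.SeparableSpace Y] [MeasurableSpace Y] [BorelSpace Y]
    {C : ℝ} (hC : ∀ y₁ y₂ : Y, dist y₁ y₂ ≤ C) {y₁ y₂ : Y} (hy : 0 < dist y₁ y₂)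
    (μ : Measure (ℕ → X)) [IsProbabilityMeasure μ] (h : SUOL Y μ) : Condition2 μ := by
  classical
  intro A _ hdis
  let κ : X → ℕ := fun x => if h : ∃ k, x ∈ A k then h.choose + 1 else 0
  have hκ : ∀ x k, x ∈ A k → κ x = k + 1 := by
    intro x k hk
    have hex : ∃ k, x ∈ A k := ⟨k, hk⟩
    simp only [κ, hex, dite_true]
    by_contra hne
    have hne' : hex.choose ≠ k := fun h => hne (by rw [h])
    exact Set.disjoint_left.1 (hdis hne') hex.choose_spec hk
  filter_upwards [suol_key hC hy μ h κ] with x hx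
  refine squeeze_zero (fun n => by positivity) (fun n => ?_) hx
  refine div_le_div_of_nonneg_right ?_ (Nat.cast_nonneg n)
  rw [← Set.ncard_coe_finset]
  refine Nat.cast_le.2 (Set.ncard_le_ncard_of_injOn (fun k => k + 1) ?_ ?_ (Finset.finite_toSet _))
  · rintro k ⟨t, ht, hk⟩
    simp only [Finset.coe_image, Set.mem_image, Finset.mem_coe]
    exact ⟨t, ht, hκ _ _ hk⟩
  · intro a _ b _ hab
    simpa using hab

/-- **Theorem 32 (Hanneke).** If `X` is countable, then `SUOL = C2`, and moreover there
exists an optimistically universal online learning rule. -/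
theorem countable_SUOL_eq_condition2_and_optimistic (X Y : Type*) [Countable X]
    [TopologicalSpace X] [TopologicalSpace.MetrizableSpace X]
    [TopologicalSpace.SeparableSpace X] [Nonempty X] [MeasurableSpace X] [BorelSpace X]
    [MetricSpace Y] [TopologicalSpace.SeparableSpace Y] [Nonempty Y]
    [MeasurableSpace Y] [BorelSpace Y]
    (hbdd : ∃ C : ℝ, ∀ y₁ y₂ : Y, dist y₁ y₂ ≤ C)
    (hnontriv : ∃ y₁ y₂ : Y, 0 < dist y₁ y₂) :
    (∀ μ : Measure (ℕ → X), IsProbabilityMeasure μ → (SUOL Y μ ↔ Condition2 μ)) ∧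
    (∃ f : ∀ n : ℕ, (Fin n → X) → (Fin n → Y) → X → Y,
        IsOnlineRule f ∧
          ∀ μ : Measure (ℕ → X), IsProbabilityMeasure μ → SUOL Y μ →
            StronglyConsistentOnl μ f) := by
  obtain ⟨C, hC⟩ := hbdd
  obtain ⟨y₁, y₂, hy⟩ := hnontriv
  have hd : DiscreteMeasurableSpace X := inferInstance
  refine ⟨fun μ hμ => ⟨fun h => suol_to_c2 hC hy μ h, fun h =>
    ⟨suolMem y₁, suolMem_rule y₁, suolMem_cons y₁ hC μ h⟩⟩,
    suolMem y₁, suolMem_rule y₁, fun μ hμ h => suolMem_cons y₁ hC μ (suol_to_c2 hC hy μ h)⟩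
end

section
/- Every process admitting strong universal self-adaptive learning admits strong universal online learning, i.e., SUAL ⊆ SUOL; moreover this inclusion is strict if and only if X is infinite. -/
open MeasureTheory Filter Topology

/-- A self-adaptive learning rule: an array of measurable functions
`f_{n,m} : X^m × Y^n × X → Y` for `m ≥ n ≥ 0`. -/
def IsSelfAdaptiveRule {X Y : Type*} [MeasurableSpace X] [MeasurableSpace Y]
    (f : ∀ n m : ℕ, (Fin m → X) → (Fin n → Y) → X → Y) : Prop :=
  ∀ n m : ℕ, n ≤ m →
    Measurable fun p : (Fin m → X) × (Fin n → Y) × X => f n m p.1 p.2.1 p.2.2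

/-- The long-run average loss `L̂_𝕏(f_{n,·}, f*; n)` of a self-adaptive learning rule
along the path `x` (0-indexed):
`limsup_{t→∞} (1/(t+1)) ∑_{m=n}^{n+t} ℓ(f_{n,m}(X_{1:m}, f*(X_{1:n}), X_{m+1}), f*(X_{m+1}))`. -/
noncomputable def adaLoss {X Y : Type*} [PseudoMetricSpace Y]
    (f : ∀ n m : ℕ, (Fin m → X) → (Fin n → Y) → X → Y)
    (fstar : X → Y) (n : ℕ) (x : ℕ → X) : ℝ :=
  Filter.limsup
    (fun t : ℕ =>
      (∑ s ∈ Finset.range (t + 1),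
          dist (f n (n + s) (fun i => x i.1) (fun i => fstar (x i.1)) (x (n + s)))
            (fstar (x (n + s)))) / ((t : ℝ) + 1))
    Filter.atTop

/-- Strong universal consistency of a self-adaptive learning rule under the process with
law `μ`. -/
def StronglyConsistentAda {X Y : Type*} [MeasurableSpace X] [MeasurableSpace Y]
    [PseudoMetricSpace Y] (μ : Measure (ℕ → X))
    (f : ∀ n m : ℕ, (Fin m → X) → (Fin n → Y) → X → Y) : Prop :=
  ∀ fstar : X → Y, Measurable fstar →
    ∀ᵐ x ∂μ, Tendsto (fun n => adaLoss f fstar n x) atTop (𝓝 0)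

/-- `SUAL`: the process with law `μ` admits strong universal self-adaptive learning. -/
def SUAL {X : Type*} (Y : Type*) [MeasurableSpace X] [MeasurableSpace Y] [PseudoMetricSpace Y]
    (μ : Measure (ℕ → X)) : Prop :=
  ∃ f : ∀ n m : ℕ, (Fin m → X) → (Fin n → Y) → X → Y,
    IsSelfAdaptiveRule f ∧ StronglyConsistentAda μ f

section sal
variable {X Y : Type*} 

def salPad {m : ℕ} (x : Fin m → X) (z : X) : ℕ → X := fun i => if h : i < m then x ⟨i, h⟩ else z

theorem salPad_meas [MeasurableSpace X] {m : ℕ} : Measurable fun p : (Fin m → X) × X => salPad p.1 p.2 := by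
  refine measurable_pi_lambda _ fun i => ?_
  unfold salPad
  by_cases h : i < m
  · simp only [h, dite_true]; fun_prop
  · simp only [h, dite_false]; fun_prop

/-- path predictors -/
structure SalGood [MeasurableSpace X] [MeasurableSpace Y] (E : ℕ → (ℕ → X) → (ℕ → Y) → Y) : Prop where
  meas : ∀ t, Measurable fun p : (ℕ → X) × (ℕ → Y) => E t p.1 p.2
  causal : ∀ t x x' y y', (∀ i ≤ t, x i = x' i) → (∀ i < t, y i = y' i) → E t x y = E t x' y'

noncomputable def salCum [PseudoMetricSpace Y] (E : ℕ → (ℕ → X) → (ℕ → Y) → Y) (t : ℕ)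
    (x : ℕ → X) (y : ℕ → Y) : ℝ := ∑ s ∈ Finset.range t, dist (E s x y) (y s)

variable [MeasurableSpace X] [MeasurableSpace Y]

theorem salCum_meas [MetricSpace Y] [SecondCountableTopology Y] [BorelSpace Y]
    {E : ℕ → (ℕ → X) → (ℕ → Y) → Y} (hE : SalGood E) (t : ℕ) :
    Measurable fun p : (ℕ → X) × (ℕ → Y) => salCum E t p.1 p.2 := by
  unfold salCum
  refine Finset.measurable_fun_sum _ fun s _ => ?_
  exact (hE.meas s).dist (by fun_prop)

theorem salCum_causal [MetricSpace Y] 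
    {E : ℕ → (ℕ → X) → (ℕ → Y) → Y} (hE : SalGood E) (t : ℕ) (x x' : ℕ → X) (y y' : ℕ → Y)
    (hx : ∀ i < t, x i = x' i) (hy : ∀ i < t, y i = y' i) : salCum E t x y = salCum E t x' y' := by
  unfold salCum
  refine Finset.sum_congr rfl fun s hs => ?_
  rw [Finset.mem_range] at hs
  rw [hE.causal s x x' y y' (fun i hi => hx i (by omega)) (fun i hi => hy i (by omega)), hy s hs]

theorem salSwitch {E : ℕ → ℕ → (ℕ → X) → (ℕ → Y) → Y} (hE : ∀ n, SalGood (E n))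
    (e : ℕ → (ℕ → X) → (ℕ → Y) → ℕ)
    (hm : ∀ t, Measurable fun p : (ℕ → X) × (ℕ → Y) => e t p.1 p.2)
    (hc : ∀ t x x' y y', (∀ i < t, x i = x' i) → (∀ i < t, y i = y' i) → e t x y = e t x' y') :
    SalGood fun t x y => E (e t x y) t x y := by
  constructor
  · intro t
    have : Measurable fun q : ℕ × ((ℕ → X) × (ℕ → Y)) => E q.1 t q.2.1 q.2.2 :=
      measurable_from_prod_countable_right fun n => (hE n).meas t
    exact this.comp ((hm t).prodMk measurable_id)
  · intro t x x' y y' hx hy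
    rw [hc t x x' y y' (fun i hi => hx i hi.le) hy]
    exact (hE _).causal t x x' y y' hx hy

theorem salStage1 [MetricSpace Y] [SecondCountableTopology Y] [BorelSpace Y]
    {C : ℝ} (hC : ∀ y₁ y₂ : Y, dist y₁ y₂ ≤ C)
    {E : ℕ → ℕ → (ℕ → X) → (ℕ → Y) → Y} (hE : ∀ n, SalGood (E n)) {δ : ℝ} (hδ : 0 < δ) :
    ∃ g, SalGood g ∧ ∀ (x : ℕ → X) (y : ℕ → Y),
      (∃ n T, ∀ s : ℕ, T ≤ s → salCum (E n) s x y ≤ δ * s) →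
      ∃ T, ∀ s : ℕ, T ≤ s → salCum g s x y ≤ 2 * δ * s := by
  classical
  let ok : ℕ → (ℕ → X) × (ℕ → Y) → ℕ → Prop := fun t p i =>
    ∀ s ≤ t, i.unpair.2 ≤ s → salCum (E i.unpair.1) s p.1 p.2 ≤ δ * s
  have hex : ∀ t p, ∃ i, ok t p i := by
    intro t p
    refine ⟨Nat.pair 0 (t+1), fun s hs h => ?_⟩
    rw [Nat.unpair_pair] at h
    simp only at h; omega
  have hokm : ∀ t i, MeasurableSet {p | ok t p i} := by
    intro t i
    simp only [ok, Set.ofPred_forall]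
    refine MeasurableSet.iInter fun s => MeasurableSet.iInter fun _ => MeasurableSet.iInter fun _ => ?_
    exact measurableSet_le (salCum_meas (hE _) s) measurable_const
  let e : ℕ → (ℕ → X) → (ℕ → Y) → ℕ := fun t x y => (Nat.find (hex t (x, y))).unpair.1
  refine ⟨fun t x y => E (e t x y) t x y, salSwitch hE e ?_ ?_, ?_⟩
  · intro t
    exact (measurable_from_nat (f := fun i => (Nat.unpair i).1)).comp (measurable_find (hex t) (hokm t))
  · intro t x x' y y' hx hy
    have : ok t (x, y) = ok t (x', y') := by
      funext i
      simp only [ok]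
      refine propext (forall_congr' fun s => forall_congr' fun hs => forall_congr' fun _ => ?_)
      rw [salCum_causal (hE _) s x x' y y' (fun i hi => hx i (by omega)) (fun i hi => hy i (by omega))]
    simp only [e]
    congr 2
    simp only [this]
  · rintro x y ⟨n, T, hT⟩
    have hg : ∃ i, ∀ t, ok t (x, y) i := by
      refine ⟨Nat.pair n T, fun t s _ h => ?_⟩
      rw [Nat.unpair_pair] at h ⊢
      exact hT s h
    let i0 := Nat.find hg
    have hi0 : ∀ t, ok t (x, y) i0 := Nat.find_spec hg
    have hbad : ∀ i < i0, ∃ t, ¬ ok t (x, y) i := fun i hi => by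
      have := Nat.find_min hg hi
      push Not at this
      exact this
    have hmono : ∀ i t t', t ≤ t' → ok t' (x, y) i → ok t (x, y) i := fun i t t' h ho s hs => ho s (hs.trans h)
    have hev : ∃ t0, ∀ i < i0, ¬ ok t0 (x, y) i := by
      choose! τ hτ using hbad
      refine ⟨(Finset.range i0).sup τ, fun i hi ho => hτ i hi (hmono i _ _ ?_ ho)⟩
      exact Finset.le_sup (f := τ) (Finset.mem_range.2 hi)
    obtain ⟨t0, ht0⟩ := hev
    have hsel : ∀ t, t0 ≤ t → e t x y = i0.unpair.1 := by
      intro t ht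
      have : Nat.find (hex t (x, y)) = i0 := by
        rw [Nat.find_eq_iff]
        exact ⟨hi0 t, fun i hi ho => ht0 i hi (hmono i _ _ ht ho)⟩
      simp only [e, this]
    have hbound : ∀ s, salCum (fun t x y => E (e t x y) t x y) s x y ≤ C * t0 + salCum (E i0.unpair.1) s x y := by
      intro s
      induction s with
      | zero =>
        have : 0 ≤ C := dist_nonneg.trans (hC (y 0) (y 0))
        simp only [salCum, Finset.range_zero, Finset.sum_empty]; positivity
      | succ s ih =>
        by_cases h : t0 ≤ s
        · have h1 : ∀ F : ℕ → (ℕ → X) → (ℕ → Y) → Y, salCum F (s+1) x y = salCum F s x y + dist (F s x y) (y s) :=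
            fun F => Finset.sum_range_succ _ _
          rw [h1, h1, hsel s h]
          linarith
        · have h2 : salCum (fun t x y => E (e t x y) t x y) (s+1) x y ≤ C * (s+1 : ℕ) := by
            unfold salCum
            refine (Finset.sum_le_card_nsmul _ _ C fun _ _ => hC _ _).trans ?_
            simp [mul_comm]
          have h3 : 0 ≤ salCum (E i0.unpair.1) (s+1) x y := Finset.sum_nonneg fun _ _ => dist_nonneg
          have h4 : ((s+1 : ℕ) : ℝ) ≤ t0 := by exact_mod_cast (by omega : s + 1 ≤ t0)
          have : 0 ≤ C := dist_nonneg.trans (hC (y 0) (y 0))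
          nlinarith
    obtain ⟨N, hN⟩ := exists_nat_ge (C * t0 / δ)
    refine ⟨max N i0.unpair.2, fun s hs => (hbound s).trans ?_⟩
    have h1 := hi0 s s le_rfl ((le_max_right _ _).trans hs)
    simp only at h1
    have h2 : (N : ℝ) ≤ s := by exact_mod_cast (le_max_left _ _).trans hs
    have h3 := (div_le_iff₀ hδ).1 (hN.trans h2)
    linarith

theorem salLog : Tendsto (fun T : ℕ => (Nat.log 2 T : ℝ) / T) atTop (𝓝 0) := by
  have h1 : Tendsto (fun T : ℕ => Real.log T / T) atTop (𝓝 0) :=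
    (Real.isLittleO_log_id_atTop.tendsto_div_nhds_zero).comp tendsto_natCast_atTop_atTop
  have h2 := h1.mul_const (1 / Real.log 2)
  rw [zero_mul] at h2
  refine squeeze_zero (fun T => by positivity) (fun T => ?_) h2
  have h3 : (Nat.log 2 T : ℝ) ≤ Real.logb (2 : ℕ) T := Real.natLog_le_logb T 2
  rw [Real.logb] at h3
  calc (Nat.log 2 T : ℝ) / T ≤ (Real.log T / Real.log (2 : ℕ)) / T := by gcongr
    _ = _ := by push_cast; ring

theorem salStage2 [MetricSpace Y] [SecondCountableTopology Y] [BorelSpace Y]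
    {C : ℝ} (hC : ∀ y₁ y₂ : Y, dist y₁ y₂ ≤ C)
    {g : ℕ → ℕ → (ℕ → X) → (ℕ → Y) → Y} (hg : ∀ n, SalGood (g n)) :
    ∃ h, SalGood h ∧ ∀ (x : ℕ → X) (y : ℕ → Y),
      (∀ k, ∃ T, ∀ s : ℕ, T ≤ s → salCum (g k) s x y ≤ (1/2 : ℝ)^k * s) →
      Tendsto (fun s : ℕ => salCum h s x y / s) atTop (𝓝 0) := by
  classical
  let ok : ℕ → (ℕ → X) × (ℕ → Y) → ℕ → Prop := fun t p k => salCum (g k) t p.1 p.2 ≤ (1/2 : ℝ)^k * t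
  let e : ℕ → (ℕ → X) → (ℕ → Y) → ℕ := fun t x y => Nat.findGreatest (ok t (x, y)) (Nat.log 2 t)
  refine ⟨fun t x y => g (e t x y) t x y, salSwitch hg e ?_ ?_, ?_⟩
  · intro t
    refine measurable_findGreatest (p := ok t) fun k _ => ?_
    exact measurableSet_le (salCum_meas (hg _) t) measurable_const
  · intro t x x' y y' hx hy
    have : ok t (x, y) = ok t (x', y') := by
      funext i
      simp only [ok]
      rw [salCum_causal (hg _) t x x' y y' hx hy]
    simp only [e, this]
  · intro x y hk
    have hC0 : 0 ≤ C := dist_nonneg.trans (hC (y 0) (y 0))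
    let h : ℕ → (ℕ → X) → (ℕ → Y) → Y := fun t x y => g (e t x y) t x y
    have hA : ∀ k T : ℕ, k ≠ 0 → ∑ t ∈ (Finset.range T).filter (fun t => e t x y = k),
        dist (g k t x y) (y t) ≤ (1/2 : ℝ)^k * T + C := by
      intro k T hk0
      set S := (Finset.range T).filter (fun t => e t x y = k) with hS
      rcases S.eq_empty_or_nonempty with h0 | hne
      · rw [h0, Finset.sum_empty]; positivity
      · have hm := S.max'_mem hne
        set m := S.max' hne
        have hm' := hm
        rw [hS, Finset.mem_filter, Finset.mem_range] at hm'
        have hokm : salCum (g k) m x y ≤ (1/2 : ℝ)^k * m :=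
          Nat.findGreatest_of_ne_zero (P := ok m (x, y)) hm'.2 hk0
        have hsub : S ⊆ Finset.range (m + 1) := fun t ht => by
          rw [Finset.mem_range]; exact Nat.lt_succ_of_le (S.le_max' t ht)
        have h1 : ∑ t ∈ S, dist (g k t x y) (y t) ≤ salCum (g k) m x y + dist (g k m x y) (y m) := by
          rw [salCum, ← Finset.sum_range_succ]
          exact Finset.sum_le_sum_of_subset_of_nonneg hsub (fun _ _ _ => dist_nonneg)
        have h2 : (m : ℝ) ≤ T := by exact_mod_cast hm'.1.le
        have h3 : (1/2 : ℝ)^k * m ≤ (1/2 : ℝ)^k * T := by gcongr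
        linarith [hC (g k m x y) (y m)]
    have hB : ∀ K : ℕ, K ≠ 0 → ∃ T0 : ℕ, ∀ T, T0 ≤ T →
        salCum h T x y ≤ C * T0 + 2 * (1/2 : ℝ)^K * T + C * (Nat.log 2 T + 1) := by
      intro K hK
      obtain ⟨T1, hT1⟩ := hk K
      refine ⟨max T1 (2^K), fun T hT => ?_⟩
      set T0 := max T1 (2^K)
      have he : ∀ t, T0 ≤ t → K ≤ e t x y := by
        intro t ht
        refine Nat.le_findGreatest ?_ (hT1 t ((le_max_left _ _).trans ht))
        have : 2^K ≤ t := (le_max_right _ _).trans ht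
        exact Nat.le_log_of_pow_le (by norm_num) this
      have hsplit : salCum h T x y = ∑ t ∈ Finset.range T0, dist (h t x y) (y t)
          + ∑ t ∈ Finset.Ico T0 T, dist (h t x y) (y t) :=
        (Finset.sum_range_add_sum_Ico _ hT).symm
      have hp1 : ∑ t ∈ Finset.range T0, dist (h t x y) (y t) ≤ C * T0 := by
        refine (Finset.sum_le_card_nsmul _ _ C fun _ _ => hC _ _).trans ?_
        simp [mul_comm]
      have hmaps : ∀ t ∈ Finset.Ico T0 T, e t x y ∈ Finset.Ico K (Nat.log 2 T + 1) := by
        intro t ht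
        rw [Finset.mem_Ico] at ht ⊢
        refine ⟨he t ht.1, Nat.lt_succ_of_le ((Nat.findGreatest_le _).trans ?_)⟩
        exact Nat.log_mono_right ht.2.le
      have hp2 : ∑ t ∈ Finset.Ico T0 T, dist (h t x y) (y t) ≤
          ∑ k ∈ Finset.Ico K (Nat.log 2 T + 1), ((1/2 : ℝ)^k * T + C) := by
        rw [← Finset.sum_fiberwise_of_maps_to hmaps]
        refine Finset.sum_le_sum fun k hk => ?_
        refine le_trans ?_ (hA k T ?_)
        · rw [Finset.sum_congr rfl (g := fun t => dist (g k t x y) (y t))]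
          · refine Finset.sum_le_sum_of_subset_of_nonneg ?_ (fun _ _ _ => dist_nonneg)
            refine Finset.filter_subset_filter _ fun t ht => ?_
            rw [Finset.mem_Ico] at ht
            exact Finset.mem_range.2 ht.2
          · intro t ht
            rw [Finset.mem_filter] at ht
            simp only [h, ht.2]
        · rw [Finset.mem_Ico] at hk; omega
      have hgeo : ∀ L : ℕ, ∑ k ∈ Finset.Ico K L, (1/2 : ℝ)^k ≤ 2 * (1/2 : ℝ)^K := by
        intro L
        have := geom_sum_Ico_le_of_lt_one (x := (1/2 : ℝ)) (m := K) (n := L) (by norm_num) (by norm_num)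
        refine this.trans (le_of_eq ?_)
        ring
      have hp3 : ∑ k ∈ Finset.Ico K (Nat.log 2 T + 1), ((1/2 : ℝ)^k * T + C) ≤
          2 * (1/2 : ℝ)^K * T + C * (Nat.log 2 T + 1) := by
        rw [Finset.sum_add_distrib, ← Finset.sum_mul]
        refine add_le_add (mul_le_mul_of_nonneg_right (hgeo _) (by positivity)) ?_
        rw [Finset.sum_const, Nat.card_Ico, nsmul_eq_mul, mul_comm]
        refine mul_le_mul_of_nonneg_left ?_ hC0
        exact_mod_cast Nat.sub_le _ _
      linarith
    rw [Metric.tendsto_atTop]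
    intro ε hε
    obtain ⟨K, hK⟩ := exists_pow_lt_of_lt_one (show 0 < ε / 8 by positivity) (show (1/2 : ℝ) < 1 by norm_num)
    obtain ⟨T0, hT0⟩ := hB (K + 1) (by omega)
    have hlim : Tendsto (fun T : ℕ => (C * T0 + C) / (T : ℝ) + C * ((Nat.log 2 T : ℝ) / T)) atTop (𝓝 (0 + C * 0)) :=
      (tendsto_const_div_atTop_nhds_zero_nat _).add (salLog.const_mul C)
    rw [mul_zero, add_zero] at hlim
    obtain ⟨N, hN⟩ := eventually_atTop.1 (hlim.eventually (gt_mem_nhds (show 0 < ε / 2 by positivity)))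
    refine ⟨max (max N T0) 1, fun T hT => ?_⟩
    have h1 := hN T (by omega)
    have h2 := hT0 T (by omega)
    have hTp : (0 : ℝ) < T := by exact_mod_cast (by omega : 0 < T)
    have h3 : 0 ≤ salCum h T x y := Finset.sum_nonneg fun _ _ => dist_nonneg
    rw [Real.dist_eq, sub_zero, abs_of_nonneg (by positivity), div_lt_iff₀ hTp]
    have h4 : (C * T0 + C) / (T : ℝ) + C * ((Nat.log 2 T : ℝ) / T) = (C * T0 + C + C * Nat.log 2 T) / T := by
      field_simp
    rw [h4, div_lt_iff₀ hTp] at h1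
    have h5 : (1/2 : ℝ)^(K+1) * T ≤ ε / 8 * T := by
      refine mul_le_mul_of_nonneg_right ?_ hTp.le
      rw [pow_succ]
      have : (0:ℝ) ≤ (1/2)^K := by positivity
      linarith
    change salCum h T x y < ε * T
    nlinarith

theorem salGood_online {E : ℕ → (ℕ → X) → (ℕ → Y) → Y} (hE : SalGood E) (y0 : Y) :
    ∃ f : ∀ n : ℕ, (Fin n → X) → (Fin n → Y) → X → Y,
      (∀ n : ℕ, Measurable fun p : (Fin n → X) × (Fin n → Y) × X => f n p.1 p.2.1 p.2.2) ∧
      ∀ t (x : ℕ → X) (y : ℕ → Y), f t (fun i => x i.1) (fun i => y i.1) (x t) = E t x y := by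
  refine ⟨fun t x y z => E t (salPad x z) (salPad y y0), fun t => ?_, fun t x y => ?_⟩
  · have h1 : Measurable fun p : (Fin t → X) × (Fin t → Y) × X => salPad p.1 p.2.2 :=
      salPad_meas.comp (measurable_fst.prodMk (measurable_snd.comp measurable_snd))
    have h2 : Measurable fun p : (Fin t → X) × (Fin t → Y) × X => salPad p.2.1 y0 :=
      salPad_meas.comp ((measurable_fst.comp measurable_snd).prodMk measurable_const)
    exact (hE.meas t).comp (h1.prodMk h2)
  · refine hE.causal _ _ _ _ _ (fun i hi => ?_) (fun i hi => ?_)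
    · unfold salPad
      split_ifs with h
      · rfl
      · rw [le_antisymm hi (not_lt.1 h)]
    · unfold salPad
      rw [dif_pos hi]

end sal

section salmain
variable {X Y : Type*} [MeasurableSpace X] [MeasurableSpace Y]

theorem sal_of_good [MetricSpace Y] {E : ℕ → (ℕ → X) → (ℕ → Y) → Y} (hE : SalGood E) (y0 : Y)
    (μ : Measure (ℕ → X))
    (h : ∀ fstar : X → Y, Measurable fstar → ∀ᵐ x ∂μ,
      Tendsto (fun s : ℕ => salCum E s x (fun i => fstar (x i)) / s) atTop (𝓝 0)) : SUOL Y μ := by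
  obtain ⟨f, hf, hfE⟩ := salGood_online hE y0
  refine ⟨f, hf, fun fstar hm => ?_⟩
  filter_upwards [h fstar hm] with x hx
  refine hx.congr fun n => ?_
  simp only [onlLoss, salCum]
  congr 1
  refine Finset.sum_congr rfl fun t _ => ?_
  rw [← hfE t x (fun i => fstar (x i))]

theorem sal_bdd [MetricSpace Y] {C : ℝ} (hC : ∀ y₁ y₂ : Y, dist y₁ y₂ ≤ C) (a b : ℕ → Y) :
    IsBoundedUnder (· ≤ ·) atTop (fun t : ℕ => (∑ s ∈ Finset.range (t + 1), dist (a s) (b s)) / ((t : ℝ) + 1)) := by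
  refine isBoundedUnder_of ⟨C, fun t => ?_⟩
  rw [div_le_iff₀ (by positivity)]
  refine (Finset.sum_le_card_nsmul _ _ C fun _ _ => hC _ _).trans ?_
  simp [mul_comm]

theorem sal_sub [MetricSpace Y] [SecondCountableTopology Y] [BorelSpace Y] (y0 : Y)
    {C : ℝ} (hC : ∀ y₁ y₂ : Y, dist y₁ y₂ ≤ C) (μ : Measure (ℕ → X)) (h : SUAL Y μ) : SUOL Y μ := by
  obtain ⟨f, hf, hcons⟩ := h
  let E : ℕ → ℕ → (ℕ → X) → (ℕ → Y) → Y := fun n t x y =>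
    if n ≤ t then f n t (fun i => x i.1) (fun i => y i.1) (x t) else y0
  have hE : ∀ n, SalGood (E n) := by
    intro n
    constructor
    · intro t
      by_cases hnt : n ≤ t
      · simp only [E, hnt, if_true]
        have h1 : Measurable fun p : (ℕ → X) × (ℕ → Y) =>
            (((fun i => p.1 i.1), (fun i => p.2 i.1), p.1 t) : (Fin t → X) × (Fin n → Y) × X) := by
          fun_prop
        exact (hf n t hnt).comp h1
      · simp only [E, hnt, if_false]; exact measurable_const
    · intro t x x' y y' hx hy
      simp only [E]
      split_ifs with hnt
      · congr 1
        · funext i; exact hx _ i.2.le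
        · funext i; exact hy _ (i.2.trans_le hnt)
        · exact hx _ le_rfl
      · rfl
  have hpos : ∀ k : ℕ, (0 : ℝ) < (1/2)^k / 2 := fun k => by positivity
  choose g hg hgb using fun k => salStage1 hC hE (hpos k)
  obtain ⟨G, hG, hGb⟩ := salStage2 hC hg
  refine sal_of_good hG y0 μ fun fstar hm => ?_
  filter_upwards [hcons fstar hm] with x hx
  refine hGb x _ fun k => ?_
  have := hgb k x (fun i => fstar (x i)) ?_
  · obtain ⟨T, hT⟩ := this
    refine ⟨T, fun s hs => (hT s hs).trans (le_of_eq (by ring))⟩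
  · set δ : ℝ := (1/2)^k / 2
    have hδ : 0 < δ := hpos k
    obtain ⟨n, hn⟩ := (hx.eventually (gt_mem_nhds (show 0 < δ / 2 by positivity))).exists
    have hev := eventually_lt_of_limsup_lt hn (sal_bdd hC _ _)
    obtain ⟨N, hN⟩ := eventually_atTop.1 hev
    obtain ⟨M, hM⟩ := exists_nat_ge (C * n / (δ / 2))
    have hC0 : 0 ≤ C := dist_nonneg.trans (hC y0 y0)
    refine ⟨n, max M (n + N + 1), fun s hs => ?_⟩
    obtain ⟨t, rfl⟩ : ∃ t, s = n + (t + 1) := ⟨s - n - 1, by omega⟩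
    have h1 := hN t (by omega)
    rw [div_lt_iff₀ (by positivity)] at h1
    have h2 : salCum (E n) (n + (t+1)) x (fun i => fstar (x i)) ≤ C * n + δ / 2 * (t + 1) := by
      unfold salCum
      rw [Finset.sum_range_add]
      refine add_le_add ?_ (le_trans (le_of_eq ?_) h1.le)
      · refine (Finset.sum_le_card_nsmul _ _ C fun _ _ => hC _ _).trans ?_
        simp [mul_comm]
      · refine Finset.sum_congr rfl fun s _ => ?_
        simp only [E, Nat.le_add_right, if_true]
    have h3 : (M : ℝ) ≤ (n + (t + 1) : ℕ) := by exact_mod_cast (by omega)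
    have h4 := (div_le_iff₀ (show 0 < δ / 2 by positivity)).1 (hM.trans h3)
    push_cast at h4 ⊢
    have h5 : 0 ≤ δ * n := by positivity
    linarith

open Classical in
/-- memorization -/
noncomputable def salMem (y0 : Y) : ℕ → (ℕ → X) → (ℕ → Y) → X → Y
  | 0, _, _, _ => y0
  | n + 1, x, y, z => if x n = z then y n else salMem y0 n x y z

theorem salMem_meas [MeasurableEq X] (y0 : Y) (n : ℕ) :
    Measurable fun p : ((ℕ → X) × (ℕ → Y)) × X => salMem y0 n p.1.1 p.1.2 p.2 := by
  induction n with
  | zero => simp only [salMem]; exact measurable_const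
  | succ n ih =>
    simp only [salMem]
    exact Measurable.ite (measurableSet_eq_fun (by fun_prop) (by fun_prop)) (by fun_prop) ih

theorem salMem_eq (y0 : Y) (n : ℕ) (x : ℕ → X) (f : X → Y) (z : X) (h : ∃ i < n, x i = z) :
    salMem y0 n x (fun i => f (x i)) z = f z := by
  induction n with
  | zero => obtain ⟨i, hi, _⟩ := h; omega
  | succ n ih =>
    simp only [salMem]
    split_ifs with h1
    · rw [h1]
    · obtain ⟨i, hi, hx⟩ := h
      refine ih ⟨i, ?_, hx⟩
      rcases Nat.lt_succ_iff_lt_or_eq.1 hi with h2 | rfl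
      · exact h2
      · exact absurd hx h1

theorem salMem_causal (y0 : Y) (n : ℕ) (x x' : ℕ → X) (y y' : ℕ → Y) (z : X)
    (hx : ∀ i < n, x i = x' i) (hy : ∀ i < n, y i = y' i) :
    salMem y0 n x y z = salMem y0 n x' y' z := by
  induction n with
  | zero => rfl
  | succ n ih =>
    simp only [salMem]
    rw [hx n (by omega), hy n (by omega),
      ih (fun i hi => hx i (by omega)) (fun i hi => hy i (by omega))]

theorem sal_finite [MeasurableEq X] [Finite X] [MetricSpace Y] (y0 : Y) (μ : Measure (ℕ → X)) :
    SUAL Y μ := by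
  refine ⟨fun n m x y z => salMem y0 n (salPad x z) (salPad y y0) z, fun n m hnm => ?_, ?_⟩
  · have h1 : Measurable fun p : (Fin m → X) × (Fin n → Y) × X => salPad p.1 p.2.2 :=
      salPad_meas.comp (measurable_fst.prodMk (measurable_snd.comp measurable_snd))
    have h2 : Measurable fun p : (Fin m → X) × (Fin n → Y) × X => salPad p.2.1 y0 :=
      salPad_meas.comp ((measurable_fst.comp measurable_snd).prodMk measurable_const)
    exact (salMem_meas y0 n).comp ((h1.prodMk h2).prodMk (measurable_snd.comp measurable_snd))
  · intro fstar _
    refine Eventually.of_forall fun x => ?_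
    have hN : ∃ N, ∀ t, ∃ i < N, x i = x t := by
      have : ∀ z : X, ∃ N, ∀ t, x t = z → ∃ i < N, x i = z := by
        intro z
        by_cases h : ∃ t, x t = z
        · obtain ⟨t, ht⟩ := h
          exact ⟨t + 1, fun _ _ => ⟨t, by omega, ht⟩⟩
        · exact ⟨0, fun t ht => absurd ⟨t, ht⟩ h⟩
      choose N hN using this
      obtain ⟨M, hM⟩ := (Set.finite_range N).bddAbove
      refine ⟨M, fun t => ?_⟩
      obtain ⟨i, hi, hx⟩ := hN (x t) t rfl
      exact ⟨i, hi.trans_le (hM ⟨_, rfl⟩), hx⟩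
    obtain ⟨N, hN⟩ := hN
    refine tendsto_const_nhds.congr' ?_
    filter_upwards [eventually_ge_atTop N] with n hn
    have h0 : ∀ s : ℕ, salMem y0 n (salPad (fun i : Fin (n + s) => x i.1) (x (n + s)))
        (salPad (fun i : Fin n => fstar (x i.1)) y0) (x (n + s)) = fstar (x (n + s)) := by
      intro s
      rw [salMem_causal y0 n _ x _ (fun i => fstar (x i))]
      · refine salMem_eq y0 n x fstar _ ?_
        obtain ⟨i, hi, hx⟩ := hN (n + s)
        exact ⟨i, hi.trans_le hn, hx⟩
      · intro i hi
        simp only [salPad]; rw [dif_pos (by omega)]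
      · intro i hi
        simp only [salPad]; rw [dif_pos hi]
    simp only [adaLoss, h0, dist_self, Finset.sum_const_zero, zero_div]
    simp

theorem sal_log_SUOL [MeasurableEq X] [MeasurableSingletonClass X] [MetricSpace Y] (y0 : Y)
    {C : ℝ} (hC : ∀ y₁ y₂ : Y, dist y₁ y₂ ≤ C) (z : ℕ → X) :
    SUOL Y (Measure.dirac (fun t : ℕ => z (Nat.log 2 (t + 1)))) := by
  have hE : SalGood (fun t (x : ℕ → X) (y : ℕ → Y) => salMem y0 t x y (x t)) := by
    constructor
    · intro t
      have h1 : Measurable fun p : (ℕ → X) × (ℕ → Y) => (p, p.1 t) := by fun_prop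
      exact (salMem_meas y0 t).comp h1
    · intro t x x' y y' hx hy
      simp only [hx t le_rfl]
      exact salMem_causal y0 t _ _ _ _ _ (fun i hi => hx i hi.le) hy
  refine sal_of_good hE y0 _ fun fstar _ => ?_
  rw [ae_dirac_eq, eventually_pure]
  have hC0 : 0 ≤ C := dist_nonneg.trans (hC y0 y0)
  have hlim : Tendsto (fun T : ℕ => C / (T : ℝ) + C * ((Nat.log 2 T : ℝ) / T)) atTop (𝓝 (0 + C * 0)) :=
    (tendsto_const_div_atTop_nhds_zero_nat _).add (salLog.const_mul C)
  rw [mul_zero, add_zero] at hlim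
  refine squeeze_zero (fun T => div_nonneg (Finset.sum_nonneg fun _ _ => dist_nonneg) (by positivity))
    (fun T => ?_) hlim
  rw [← mul_div_assoc, ← add_div]
  refine div_le_div_of_nonneg_right ?_ (by positivity)
  simp only [salCum]
  set x : ℕ → X := fun t : ℕ => z (Nat.log 2 (t + 1))
  have hle : ∀ t ∈ Finset.range T, dist (salMem y0 t x (fun i => fstar (x i)) (x t)) (fstar (x t)) ≤
      if ∀ i < t, Nat.log 2 (i + 1) ≠ Nat.log 2 (t + 1) then C else 0 := by
    intro t _
    split_ifs with h
    · exact hC _ _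
    · push Not at h
      obtain ⟨i, hi, hl⟩ := h
      rw [salMem_eq y0 t x fstar _ ⟨i, hi, by simp only [x, hl]⟩, dist_self]
  refine (Finset.sum_le_sum hle).trans ?_
  rw [← Finset.sum_filter, Finset.sum_const, nsmul_eq_mul, ← mul_one_add, mul_comm]
  refine mul_le_mul_of_nonneg_left ?_ hC0
  have hcard : (Finset.filter (fun t => ∀ i < t, Nat.log 2 (i + 1) ≠ Nat.log 2 (t + 1)) (Finset.range T)).card
      ≤ (Finset.range (Nat.log 2 T + 1)).card := by
    refine Finset.card_le_card_of_injOn (fun t => Nat.log 2 (t + 1)) ?_ ?_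
    · intro t ht
      simp only [Finset.coe_filter, Finset.mem_range] at ht
      simp only [Finset.coe_range, Set.mem_Iio]
      exact Nat.lt_succ_of_le (Nat.log_mono_right ht.1)
    · intro a ha b hb hab
      simp only [Finset.coe_filter, Finset.mem_range] at ha hb
      rcases lt_trichotomy a b with h | h | h
      · exact absurd hab (hb.2 a h)
      · exact h
      · exact absurd hab.symm (ha.2 b h)
  rw [Finset.card_range] at hcard
  have : ((Finset.filter (fun t => ∀ i < t, Nat.log 2 (i + 1) ≠ Nat.log 2 (t + 1)) (Finset.range T)).card : ℝ)
      ≤ (Nat.log 2 T + 1 : ℕ) := by exact_mod_cast hcard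
  push_cast at this
  linarith

def salRec (F : ℕ → (ℕ → Bool) → Bool) (k : ℕ) : Bool :=
  F k (fun i => if _h : i < k then salRec F i else false)
termination_by k

theorem salRec_exists (P : ℕ → (ℕ → Bool) → Bool → Prop) (hP : ∀ k g, ∃ b, P k g b)
    (hc : ∀ k g g' b, (∀ i < k, g i = g' i) → P k g b → P k g' b) : ∃ g : ℕ → Bool, ∀ k, P k g (g k) := by
  choose F hF using hP
  refine ⟨salRec F, fun k => ?_⟩
  rw [salRec]
  refine hc k _ _ _ ?_ (hF k _)
  intro i hi
  simp [hi]

theorem sal_log_not [MeasurableSingletonClass X] [MetricSpace Y]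
    {C : ℝ} (hC : ∀ y₁ y₂ : Y, dist y₁ y₂ ≤ C) {ya yb : Y} (hab : 0 < dist ya yb)
    (z : ℕ → X) (hz : Function.Injective z) :
    ¬ SUAL Y (Measure.dirac (fun t : ℕ => z (Nat.log 2 (t + 1)))) := by
  classical
  rintro ⟨f, -, hcons⟩
  set x : ℕ → X := fun t : ℕ => z (Nat.log 2 (t + 1)) with hxdef
  let lab : Bool → Y := fun b => if b then ya else yb
  let pr : ℕ → (ℕ → Bool) → ℕ → Y := fun n g t =>
    f n t (fun i => x i.1) (fun i => lab (g (Nat.log 2 (i.1 + 1)))) (x t)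
  obtain ⟨g, hg⟩ := salRec_exists (fun k g b => dist ya yb / 2 * 2^k ≤
      ∑ t ∈ Finset.Ico (2^k - 1) (2^(k+1) - 1), dist (pr k.unpair.1 g t) (lab b)) (by
    intro k g
    by_contra! hcon
    have h1 := hcon true
    have h2 := hcon false
    have h3 : dist ya yb * 2^k ≤ ∑ t ∈ Finset.Ico (2^k - 1) (2^(k+1) - 1),
        (dist (pr k.unpair.1 g t) (lab true) + dist (pr k.unpair.1 g t) (lab false)) := by
      have h4 := Finset.card_nsmul_le_sum (Finset.Ico (2^k - 1) (2^(k+1) - 1)) (fun t => 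
        (dist (pr k.unpair.1 g t) (lab true) + dist (pr k.unpair.1 g t) (lab false))) (dist ya yb) (fun t _ => by
          simp only [lab, if_true]
          rw [dist_comm _ ya]
          simpa using dist_triangle ya (pr k.unpair.1 g t) yb)
      have h5 : (2^(k+1) - 1) - (2^k - 1) = 2^k := by
        have : 0 < 2^k := by positivity
        rw [pow_succ]; omega
      rw [Nat.card_Ico, h5, nsmul_eq_mul] at h4
      push_cast at h4
      linarith
    rw [Finset.sum_add_distrib] at h3
    linarith) (by
    intro k g g' b hgg hb
    have : pr k.unpair.1 g = pr k.unpair.1 g' := by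
      funext t
      simp only [pr]
      congr 1
      funext i
      rw [hgg]
      have h1 : i.1 < k := i.2.trans_le (Nat.unpair_left_le k)
      refine Nat.log_lt_of_lt_pow (by omega) ?_
      have := Nat.lt_two_pow_self (n := k)
      omega
    rwa [this] at hb)
  let fstar : X → Y := fun a => if a ∈ z '' {k | g k = true} then ya else yb
  have hfm : Measurable fstar := by
    refine Measurable.ite ?_ measurable_const measurable_const
    exact ((Set.to_countable _).image z).measurableSet
  have hfz : ∀ k, fstar (z k) = lab (g k) := by
    intro k
    simp only [fstar, lab, hz.mem_set_image, Set.mem_ofPred_eq]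
  have hc := hcons fstar hfm
  rw [ae_dirac_eq, eventually_pure] at hc
  have hlow : ∀ n, dist ya yb / 4 ≤ adaLoss f fstar n x := by
    intro n
    refine le_limsup_of_frequently_le ?_ (sal_bdd hC _ _)
    rw [frequently_atTop]
    intro N
    set k := Nat.pair n (n + N) with hk
    have hk1 : n + N ≤ k := Nat.right_le_pair _ _
    have hk2 : k.unpair.1 = n := by rw [hk, Nat.unpair_pair]
    have hk3 := Nat.lt_two_pow_self (n := k)
    have hk4 : 2^(k+1) = 2 * 2^k := by rw [pow_succ]; ring
    refine ⟨2^(k+1) - 2 - n, by omega, ?_⟩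
    rw [le_div_iff₀ (by positivity)]
    have h1 := hg k
    rw [hk2] at h1
    have h2 : ∑ t ∈ Finset.Ico (2^k - 1) (2^(k+1) - 1), dist (pr n g t) (lab (g k)) =
        ∑ t ∈ Finset.Ico (2^k - 1) (2^(k+1) - 1), 
          dist (f n t (fun i => x i.1) (fun i => fstar (x i.1)) (x t)) (fstar (x t)) := by
      refine Finset.sum_congr rfl fun t ht => ?_
      rw [Finset.mem_Ico] at ht
      have h3 : Nat.log 2 (t + 1) = k := by
        rw [Nat.log_eq_iff (by right; omega)]
        omega
      simp only [pr, hxdef, hfz, h3]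
    have h3 : ∑ t ∈ Finset.Ico (2^k - 1) (2^(k+1) - 1), 
          dist (f n t (fun i => x i.1) (fun i => fstar (x i.1)) (x t)) (fstar (x t)) ≤
        ∑ t ∈ Finset.Ico n (n + (2^(k+1) - 2 - n + 1)), 
          dist (f n t (fun i => x i.1) (fun i => fstar (x i.1)) (x t)) (fstar (x t)) := by
      refine Finset.sum_le_sum_of_subset_of_nonneg ?_ (fun _ _ _ => dist_nonneg)
      refine Finset.Ico_subset_Ico (by omega) (by omega)
    rw [Finset.sum_Ico_eq_sum_range _ n, Nat.add_sub_cancel_left] at h3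
    rw [h2] at h1
    refine le_trans ?_ (h1.trans h3)
    have h4 : (((2^(k+1) - 2 - n : ℕ) : ℝ) + 1) ≤ 2 * 2^k := by
      have : 2^(k+1) - 2 - n + 1 ≤ 2 * 2^k := by omega
      exact_mod_cast this
    nlinarith
  have := ge_of_tendsto' hc hlow
  linarith

end salmain

/-- **Theorem 34 (Hanneke).** `SUAL ⊆ SUOL`, and the inclusion is strict iff `X` is
infinite. -/
theorem SUAL_subset_SUOL (X Y : Type*)
    [TopologicalSpace X] [TopologicalSpace.MetrizableSpace X]
    [TopologicalSpace.SeparableSpace X] [Nonempty X] [MeasurableSpace X] [BorelSpace X]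
    [MetricSpace Y] [TopologicalSpace.SeparableSpace Y] [Nonempty Y]
    [MeasurableSpace Y] [BorelSpace Y]
    (hbdd : ∃ C : ℝ, ∀ y₁ y₂ : Y, dist y₁ y₂ ≤ C)
    (hnontriv : ∃ y₁ y₂ : Y, 0 < dist y₁ y₂) :
    (∀ μ : Measure (ℕ → X), IsProbabilityMeasure μ → SUAL Y μ → SUOL Y μ) ∧
    ((∃ μ : Measure (ℕ → X), IsProbabilityMeasure μ ∧ SUOL Y μ ∧ ¬ SUAL Y μ) ↔
      Infinite X) := by
  obtain ⟨C, hC⟩ := hbdd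
  obtain ⟨ya, yb, hab⟩ := hnontriv
  letI : MetricSpace X := TopologicalSpace.metrizableSpaceMetric X
  haveI : SecondCountableTopology X := UniformSpace.secondCountable_of_separable X
  haveI : SecondCountableTopology Y := UniformSpace.secondCountable_of_separable Y
  refine ⟨fun μ _ h => sal_sub ya hC μ h, ?_, ?_⟩
  · rintro ⟨μ, _, _, hn⟩
    by_contra hinf
    rw [not_infinite_iff_finite] at hinf
    exact hn (sal_finite ya μ)
  · intro hinf
    let z := Infinite.natEmbedding X
    exact ⟨_, inferInstance, sal_log_SUOL ya hC z, sal_log_not hC hab z z.injective⟩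
end

section
/- Every process satisfying Condition 1 satisfies Condition 2, i.e., C1 ⊆ C2; moreover this inclusion is strict if and only if X is infinite. -/
open MeasureTheory Filter Topology

theorem hit_sum_bounds {X : Type*} (x : ℕ → X) (B : Set X) (n : ℕ) :
    0 ≤ (∑ t ∈ Finset.range n, B.indicator (fun _ => (1 : ℝ)) (x t)) / (n : ℝ) ∧
    (∑ t ∈ Finset.range n, B.indicator (fun _ => (1 : ℝ)) (x t)) / (n : ℝ) ≤ 1 := by
  constructor
  · refine div_nonneg (Finset.sum_nonneg fun t _ => ?_) (Nat.cast_nonneg n)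
    exact Set.indicator_nonneg (fun _ _ => zero_le_one) _
  · refine div_le_one_of_le₀ ?_ (Nat.cast_nonneg n)
    calc _ ≤ ∑ t ∈ Finset.range n, (1 : ℝ) := Finset.sum_le_sum fun t _ =>
          Set.indicator_le_self' (fun _ _ => zero_le_one) _
      _ = n := by simp

theorem hit_bdd {X : Type*} (x : ℕ → X) (B : Set X) :
    IsBoundedUnder (· ≤ ·) atTop (fun n : ℕ =>
      (∑ t ∈ Finset.range n, B.indicator (fun _ => (1 : ℝ)) (x t)) / (n : ℝ)) :=
  isBoundedUnder_of ⟨1, fun n => (hit_sum_bounds x B n).2⟩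

theorem hit_cobdd {X : Type*} (x : ℕ → X) (B : Set X) :
    IsCoboundedUnder (· ≤ ·) atTop (fun n : ℕ =>
      (∑ t ∈ Finset.range n, B.indicator (fun _ => (1 : ℝ)) (x t)) / (n : ℝ)) :=
  (isBoundedUnder_of ⟨0, fun n => (hit_sum_bounds x B n).1⟩ :
    IsBoundedUnder (· ≥ ·) atTop _).isCoboundedUnder_le

theorem muHatSet_nonneg' {X : Type*} (x : ℕ → X) (B : Set X) : 0 ≤ muHatSet x B :=
  le_limsup_of_frequently_le
    (Frequently.of_forall fun n => (hit_sum_bounds x B n).1) (hit_bdd x B)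

theorem muHatSet_le_one' {X : Type*} (x : ℕ → X) (B : Set X) : muHatSet x B ≤ 1 :=
  limsup_le_of_le (hit_cobdd x B) (Eventually.of_forall fun n => (hit_sum_bounds x B n).2)

theorem measurable_muHatSet' {X : Type*} [MeasurableSpace X] {B : Set X} (hB : MeasurableSet B) :
    Measurable (fun x : ℕ → X => muHatSet x B) := by
  refine Measurable.limsup fun n => ?_
  refine Measurable.div_const ?_ _
  refine Finset.measurable_fun_sum _ fun t _ => ?_
  exact (measurable_const.indicator hB).comp (measurable_pi_apply t)

/-- the set of indices hit by a finite set of points is bounded by its cardinality -/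
theorem ncard_hit_le {X : Type*} [DecidableEq X] (A : ℕ → Set X)
    (hd : Pairwise fun k l => Disjoint (A k) (A l)) (S : Finset X) :
    {k : ℕ | ∃ y ∈ S, y ∈ A k}.Finite ∧ {k : ℕ | ∃ y ∈ S, y ∈ A k}.ncard ≤ S.card := by
  classical
  let c : X → ℕ := fun y => if h : ∃ k, y ∈ A k then h.choose else 0
  have hc : ∀ y k, y ∈ A k → c y = k := by
    intro y k hy
    have h : ∃ k, y ∈ A k := ⟨k, hy⟩
    have e : c y = h.choose := dif_pos h
    rw [e]
    by_contra hne
    exact Set.disjoint_left.1 (hd hne) h.choose_spec hy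
  have hsub : {k : ℕ | ∃ y ∈ S, y ∈ A k} ⊆ ((S.image c : Finset ℕ) : Set ℕ) := by
    rintro k ⟨y, hy, hk⟩
    rw [Finset.mem_coe, Finset.mem_image]
    exact ⟨y, hy, hc y k hk⟩
  refine ⟨(Finset.finite_toSet _).subset hsub, ?_⟩
  calc _ ≤ ((S.image c : Finset ℕ) : Set ℕ).ncard := Set.ncard_le_ncard hsub (Finset.finite_toSet _)
    _ = (S.image c).card := Set.ncard_coe_finset _
    _ ≤ S.card := Finset.card_image_le

theorem ncard_hit_tail {X : Type*} (A : ℕ → Set X)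
    (hd : Pairwise fun k l => Disjoint (A k) (A l)) (x : ℕ → X) (K T : ℕ) :
    ({k : ℕ | ∃ t ∈ Finset.range T, x t ∈ A k}.ncard : ℝ) ≤
      K + ∑ t ∈ Finset.range T, (⋃ j ≥ K, A j).indicator (fun _ => (1 : ℝ)) (x t) := by
  classical
  let F := (Finset.range T).filter fun t => x t ∈ ⋃ j ≥ K, A j
  have h1 := ncard_hit_le A hd (F.image x)
  have hsub : {k : ℕ | ∃ t ∈ Finset.range T, x t ∈ A k} ⊆
      (Finset.range K : Set ℕ) ∪ {k : ℕ | ∃ y ∈ F.image x, y ∈ A k} := by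
    rintro k ⟨t, ht, hk⟩
    by_cases hK : k < K
    · left; simpa using hK
    · right
      refine ⟨x t, Finset.mem_image_of_mem _ (Finset.mem_filter.2 ⟨ht, ?_⟩), hk⟩
      simp only [Set.mem_iUnion]
      exact ⟨k, not_lt.1 hK, hk⟩
  have h2 : {k : ℕ | ∃ t ∈ Finset.range T, x t ∈ A k}.ncard ≤ K + F.card := by
    calc _ ≤ _ := Set.ncard_le_ncard hsub ((Finset.finite_toSet _).union h1.1)
      _ ≤ _ := Set.ncard_union_le _ _
      _ ≤ K + F.card := by
        gcongr
        · rw [Set.ncard_coe_finset]; simp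
        · exact h1.2.trans Finset.card_image_le
  have h3 : (F.card : ℝ) =
      ∑ t ∈ Finset.range T, (⋃ j ≥ K, A j).indicator (fun _ => (1 : ℝ)) (x t) := by
    simp only [F, Finset.card_filter, Set.indicator_apply]
    push_cast
    rfl
  rw [← h3]
  exact_mod_cast h2

theorem c1_c2 {X : Type*} [MeasurableSpace X] (μ : Measure (ℕ → X)) [IsProbabilityMeasure μ]
    (h : Condition1 μ) : Condition2 μ := by
  intro A hA hd
  let B : ℕ → Set X := fun K => ⋃ j ≥ K, A j
  have hB : ∀ k, MeasurableSet (B k) := fun k =>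
    MeasurableSet.iUnion fun j => MeasurableSet.iUnion fun _ => hA j
  have hBa : Antitone B := by
    intro a b hab y hy
    simp only [B, Set.mem_iUnion] at hy ⊢
    obtain ⟨j, hj, hy⟩ := hy
    exact ⟨j, hab.trans hj, hy⟩
  have hBe : (⋂ k, B k) = ∅ := by
    rw [Set.eq_empty_iff_forall_notMem]
    intro y hy
    simp only [B, Set.mem_iInter, Set.mem_iUnion] at hy
    obtain ⟨j, _, hj⟩ := hy 0
    obtain ⟨l, hl, hl'⟩ := hy (j + 1)
    exact Set.disjoint_left.1 (hd (show j ≠ l by omega)) hj hl'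
  have ht := h B hB hBa hBe
  let g : (ℕ → X) → ℝ := fun x => ⨅ k, muHatSet x (B k)
  have hbdd : ∀ x, BddBelow (Set.range fun k => muHatSet x (B k)) := fun x =>
    ⟨0, by rintro _ ⟨k, rfl⟩; exact muHatSet_nonneg' x _⟩
  have hgm : Measurable g := Measurable.iInf fun k => measurable_muHatSet' (hB k)
  have hg0 : ∀ x, 0 ≤ g x := fun x => le_ciInf fun k => muHatSet_nonneg' x _
  have hgle : ∀ k x, g x ≤ muHatSet x (B k) := fun k x => ciInf_le (hbdd x) k
  have hint : ∀ f : (ℕ → X) → ℝ, Measurable f → (∀ x, 0 ≤ f x) → (∀ x, f x ≤ 1) →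
      Integrable f μ := by
    intro f hf h0 h1
    refine Integrable.of_bound hf.aestronglyMeasurable 1 (Eventually.of_forall fun x => ?_)
    rw [Real.norm_eq_abs, abs_of_nonneg (h0 x)]
    exact h1 x
  have hgi : Integrable g μ := hint g hgm hg0 fun x => (hgle 0 x).trans (muHatSet_le_one' _ _)
  have hI : ∫ x, g x ∂μ = 0 := by
    refine le_antisymm (ge_of_tendsto' ht fun k => ?_) (integral_nonneg hg0)
    exact integral_mono hgi (hint _ (measurable_muHatSet' (hB k))
      (fun x => muHatSet_nonneg' x _) (fun x => muHatSet_le_one' x _)) (hgle k)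
  rw [integral_eq_zero_iff_of_nonneg hg0 hgi] at hI
  filter_upwards [hI] with x hx
  have hx : (⨅ k, muHatSet x (B k)) = 0 := hx
  rw [Metric.tendsto_atTop']
  intro ε hε
  obtain ⟨K, hK⟩ := exists_lt_of_ciInf_lt (show (⨅ k, muHatSet x (B k)) < ε / 2 by
    rw [hx]; positivity)
  have e1 := eventually_lt_of_limsup_lt hK (hit_bdd x (B K))
  have e2 : ∀ᶠ T : ℕ in atTop, (K : ℝ) / (T : ℝ) < ε / 2 :=
    (tendsto_const_div_atTop_nhds_zero_nat (K : ℝ)).eventually_lt_const (by positivity)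
  obtain ⟨N, hN⟩ := eventually_atTop.1 (e1.and e2)
  refine ⟨N, fun T hT => ?_⟩
  obtain ⟨a, b⟩ := hN T hT.le
  rw [Real.dist_eq, sub_zero, abs_of_nonneg (by positivity)]
  calc _ ≤ (K + ∑ t ∈ Finset.range T, (B K).indicator (fun _ => (1 : ℝ)) (x t)) / (T : ℝ) := by
        gcongr
        exact ncard_hit_tail A hd x K T
    _ < ε := by rw [add_div]; linarith

theorem muHatSet_eq_of_ev {X : Type*} (x : ℕ → X) (B : Set X)
    (h : ∀ᶠ t in atTop, x t ∈ B) : muHatSet x B = 1 := by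
  have h1 : Tendsto (fun t => B.indicator (fun _ => (1 : ℝ)) (x t)) atTop (𝓝 1) := by
    refine tendsto_const_nhds.congr' ?_
    filter_upwards [h] with t ht
    rw [Set.indicator_of_mem ht]
  refine Tendsto.limsup_eq (h1.cesaro.congr fun n => ?_)
  rw [div_eq_inv_mul]

theorem c1_of_finite {X : Type*} [MeasurableSpace X] [Finite X] (μ : Measure (ℕ → X)) :
    Condition1 μ := by
  intro A _ ha he
  have : ∀ᶠ k in atTop, A k = ∅ := by
    have h1 : ∀ y : X, ∀ᶠ k in atTop, y ∉ A k := by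
      intro y
      have : y ∉ ⋂ k, A k := by rw [he]; simp
      rw [Set.mem_iInter, not_forall] at this
      obtain ⟨k, hk⟩ := this
      filter_upwards [eventually_ge_atTop k] with l hl h
      exact hk (ha hl h)
    filter_upwards [eventually_all.2 h1] with k hk
    exact Set.eq_empty_iff_forall_notMem.2 hk
  refine tendsto_const_nhds.congr' ?_
  filter_upwards [this] with k hk
  rw [hk]
  simp [muHatSet, muHat]

theorem strict_of_infinite {X : Type*} [MeasurableSpace X] [MeasurableSingletonClass X]
    [Infinite X] :
    ∃ μ : Measure (ℕ → X), IsProbabilityMeasure μ ∧ Condition2 μ ∧ ¬ Condition1 μ := by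
  classical
  let z := Infinite.natEmbedding X
  let x : ℕ → X := fun t => z (Nat.sqrt t)
  refine ⟨Measure.dirac x, inferInstance, ?_, ?_⟩
  · intro A hA hd
    rw [ae_dirac_eq]
    change Tendsto _ _ _
    have hb : ∀ T : ℕ, ({k : ℕ | ∃ t ∈ Finset.range T, x t ∈ A k}.ncard : ℝ) ≤ √T + 1 := by
      intro T
      have h1 := ncard_hit_le A hd ((Finset.range (Nat.sqrt T + 1)).image z)
      have hsub : {k : ℕ | ∃ t ∈ Finset.range T, x t ∈ A k} ⊆
          {k : ℕ | ∃ y ∈ (Finset.range (Nat.sqrt T + 1)).image z, y ∈ A k} := by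
        rintro k ⟨t, ht, hk⟩
        refine ⟨x t, Finset.mem_image_of_mem _ ?_, hk⟩
        rw [Finset.mem_range] at ht ⊢
        exact Nat.lt_succ_of_le (Nat.sqrt_le_sqrt ht.le)
      have h2 : {k : ℕ | ∃ t ∈ Finset.range T, x t ∈ A k}.ncard ≤ Nat.sqrt T + 1 :=
        (Set.ncard_le_ncard hsub h1.1).trans (h1.2.trans (Finset.card_image_le.trans (by simp)))
      have h3 : ((Nat.sqrt T : ℕ) : ℝ) ≤ √T := Real.nat_sqrt_le_real_sqrt
      have h4 : ({k : ℕ | ∃ t ∈ Finset.range T, x t ∈ A k}.ncard : ℝ) ≤ (Nat.sqrt T : ℝ) + 1 := by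
        exact_mod_cast h2
      linarith
    have hl : Tendsto (fun T : ℕ => (√(T : ℝ))⁻¹ + 1 / (T : ℝ)) atTop (𝓝 0) := by
      have := ((tendsto_inv_atTop_zero.comp
        (Real.tendsto_sqrt_atTop.comp (tendsto_natCast_atTop_atTop (R := ℝ))))).add
        (tendsto_const_div_atTop_nhds_zero_nat (1 : ℝ))
      simpa using this
    refine squeeze_zero (fun T => by positivity) (fun T => ?_) hl
    calc _ ≤ (√(T : ℝ) + 1) / (T : ℝ) := by gcongr; exact hb T
      _ = _ := by rw [add_div, Real.sqrt_div_self', one_div]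
  · intro h
    have := h (fun k => z '' Set.Ici k)
      (fun k => ((Set.to_countable _).image z).measurableSet)
      (fun a b hab => Set.image_mono (Set.Ici_subset_Ici.2 hab)) (by
        rw [Set.eq_empty_iff_forall_notMem]
        intro y hy
        rw [Set.mem_iInter] at hy
        obtain ⟨i, _, rfl⟩ := hy 0
        obtain ⟨j, hj, e⟩ := hy (i + 1)
        have := z.injective e
        simp only [Set.mem_Ici] at hj
        omega)
    have h1 : ∀ k, muHatSet x (z '' Set.Ici k) = 1 := by
      intro k
      refine muHatSet_eq_of_ev _ _ ?_
      filter_upwards [eventually_ge_atTop (k * k)] with t ht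
      exact ⟨Nat.sqrt t, Nat.le_sqrt.2 ht, rfl⟩
    simp only [integral_dirac, h1] at this
    exact zero_ne_one (tendsto_nhds_unique this tendsto_const_nhds)

/-- **Corollary 36 (Hanneke).** `C1 ⊆ C2`, and the inclusion is strict iff `X` is
infinite. -/
theorem condition1_subset_condition2 (X : Type*)
    [TopologicalSpace X] [TopologicalSpace.MetrizableSpace X]
    [TopologicalSpace.SeparableSpace X] [Nonempty X] [MeasurableSpace X] [BorelSpace X] :
    (∀ μ : Measure (ℕ → X), IsProbabilityMeasure μ → Condition1 μ → Condition2 μ) ∧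
    ((∃ μ : Measure (ℕ → X), IsProbabilityMeasure μ ∧ Condition2 μ ∧ ¬ Condition1 μ) ↔
      Infinite X) := by
  refine ⟨fun μ _ h => c1_c2 μ h, ?_, fun _ => strict_of_infinite⟩
  rintro ⟨μ, _, _, h⟩
  by_contra hX
  have : Finite X := not_infinite_iff_finite.1 hX
  exact h (c1_of_finite μ)
end

section
/- If X is infinite, then there does not exist a consistent hypothesis test for SUIL, nor for SUAL, nor for SUOL: for every hypothesis test t̂_n there is a process 𝕏 for which t̂_n fails to be consistent for each of these three families. -/
open MeasureTheory Filter Topology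

/-- An inductive learning rule: a sequence of measurable functions
`f_n : X^n × Y^n × X → Y`. -/
def IsInductiveRule {X Y : Type*} [MeasurableSpace X] [MeasurableSpace Y]
    (f : ∀ n : ℕ, (Fin n → X) → (Fin n → Y) → X → Y) : Prop :=
  ∀ n : ℕ, Measurable fun p : (Fin n → X) × (Fin n → Y) × X => f n p.1 p.2.1 p.2.2

/-- The long-run average loss `L̂_𝕏(f_n, f*; n)` of an inductive learning rule along the
path `x` (0-indexed, so `x 0, x 1, …` are `X_1, X_2, …`):
`limsup_{t→∞} (1/t) ∑_{m=n+1}^{n+t} ℓ(f_n(X_{1:n}, f*(X_{1:n}), X_m), f*(X_m))`. -/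
noncomputable def indLoss {X Y : Type*} [PseudoMetricSpace Y]
    (f : ∀ n : ℕ, (Fin n → X) → (Fin n → Y) → X → Y)
    (fstar : X → Y) (n : ℕ) (x : ℕ → X) : ℝ :=
  Filter.limsup
    (fun t : ℕ =>
      (∑ s ∈ Finset.range t,
          dist (f n (fun i => x i.1) (fun i => fstar (x i.1)) (x (n + s)))
            (fstar (x (n + s)))) / (t : ℝ))
    Filter.atTop

/-- Strong universal consistency of an inductive learning rule under the process with
law `μ`: for every measurable target `f*`, `L̂_𝕏(f_n, f*; n) → 0` almost surely. -/
def StronglyConsistentInd {X Y : Type*} [MeasurableSpace X] [MeasurableSpace Y]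
    [PseudoMetricSpace Y] (μ : Measure (ℕ → X))
    (f : ∀ n : ℕ, (Fin n → X) → (Fin n → Y) → X → Y) : Prop :=
  ∀ fstar : X → Y, Measurable fstar →
    ∀ᵐ x ∂μ, Tendsto (fun n => indLoss f fstar n x) atTop (𝓝 0)

/-- `SUIL`: the process with law `μ` admits strong universal inductive learning. -/
def SUIL {X : Type*} (Y : Type*) [MeasurableSpace X] [MeasurableSpace Y] [PseudoMetricSpace Y]
    (μ : Measure (ℕ → X)) : Prop :=
  ∃ f : ∀ n : ℕ, (Fin n → X) → (Fin n → Y) → X → Y,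
    IsInductiveRule f ∧ StronglyConsistentInd μ f

/-- Correct behaviour of a hypothesis test `t` at the process with law `μ`, relative to a
family `P` of processes: `t_n(X_{1:n}) → 1` in probability if `P` holds, and
`t_n(X_{1:n}) → 0` in probability if `P` fails.  (Since `t` is `{0,1}`-valued, convergence
in probability to `1` resp. `0` is exactly the displayed convergence of probabilities.) -/
def TestCorrectAt {X : Type*} [MeasurableSpace X]
    (t : ∀ n : ℕ, (Fin n → X) → Bool) (P : Measure (ℕ → X) → Prop)
    (μ : Measure (ℕ → X)) : Prop :=
  (P μ → Tendsto (fun n => μ {x | t n (fun i => x i.1) = false}) atTop (𝓝 0)) ∧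
  (¬ P μ → Tendsto (fun n => μ {x | t n (fun i => x i.1) = true}) atTop (𝓝 0))

noncomputable def seqRec {α : Type*} (y0 : α) (F : ℕ → (ℕ → α) → α) : ℕ → α
  | m => F m (fun i => if _h : i < m then seqRec y0 F i else y0)
  termination_by m => m

theorem seqRec_spec {α : Type*} (y0 : α) (F : ℕ → (ℕ → α) → α)
    (hF : ∀ m l l', (∀ i < m, l i = l' i) → F m l = F m l') (m : ℕ) :
    seqRec y0 F m = F m (seqRec y0 F) := by
  rw [seqRec]
  apply hF
  intro i hi
  simp [hi]

/-- the adversarial labelling -/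
theorem exists_bad_target {X Y : Type*} [TopologicalSpace X] [T1Space X]
    [MeasurableSpace X] [BorelSpace X] [MetricSpace Y] [MeasurableSpace Y]
    (y₁ y₂ : Y) (a : ℕ → X) (N : ℕ)
    (hfresh : ∀ m, N ≤ m → ∀ i < m, a i ≠ a m)
    (p : ℕ → ℕ → (ℕ → Y) → Y)
    (hp : ∀ n m l l', n ≤ m → (∀ i < m, l i = l' i) → p n m l = p n m l') :
    ∃ fstar : X → Y, Measurable fstar ∧ ∀ n M : ℕ, ∃ T, M ≤ T ∧ 1 ≤ T ∧
      dist y₁ y₂ / 4 * T ≤ ∑ s ∈ Finset.range T,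
        dist (p n (n + s) (fun i => fstar (a i))) (fstar (a (n + s))) := by
  classical
  let g : ℕ → ℕ := fun m => (Nat.unpair (Nat.log 2 m)).1
  have hg : ∀ m, g m ≤ m := fun m => (Nat.unpair_left_le _).trans (Nat.log_le_self _ _)
  let F : ℕ → (ℕ → Y) → Y := fun m l =>
    if m < N then y₁ else
      if dist y₁ y₂ / 2 ≤ dist (p (g m) m l) y₁ then y₁ else y₂
  let lab := seqRec y₁ F
  have hlab : ∀ m, lab m = F m lab := seqRec_spec y₁ F (by
    intro m l l' h
    simp only [F, hp (g m) m l l' (hg m) h])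
  have hval : ∀ m, lab m = y₁ ∨ lab m = y₂ := by
    intro m
    rw [hlab]
    simp only [F]
    split_ifs <;> simp
  have hbad : ∀ m, N ≤ m → dist y₁ y₂ / 2 ≤ dist (p (g m) m lab) (lab m) := by
    intro m hm
    rw [hlab m]
    simp only [F, not_lt.mpr hm, if_false]
    split_ifs with h
    · exact h
    · have := dist_triangle_left y₁ y₂ (p (g m) m lab)
      linarith
  let S : Set X := a '' {m | N ≤ m ∧ lab m = y₂}
  have hS : MeasurableSet S := ((Set.to_countable _).image a).measurableSet
  let fstar : X → Y := fun x => if x ∈ S then y₂ else y₁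
  have hfs : (fun i => fstar (a i)) = lab := by
    funext m
    simp only [fstar]
    split_ifs with h
    · obtain ⟨k, ⟨hk, hk2⟩, hka⟩ := h
      rcases lt_trichotomy k m with hlt | rfl | hlt
      · exact absurd hka (hfresh m (hk.trans hlt.le) k hlt)
      · exact hk2.symm
      · exact absurd hka.symm (hfresh k hk m hlt)
    · by_cases hm : m < N
      · rw [hlab]; simp [F, hm]
      · rcases hval m with h1 | h1
        · exact h1.symm
        · exact absurd ⟨m, ⟨not_lt.mp hm, h1⟩, rfl⟩ h
  refine ⟨fstar, Measurable.ite hS measurable_const measurable_const, ?_⟩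
  intro n M
  let k := Nat.pair n (n + M + N + 1)
  have hk : n + M + N + 1 ≤ k := Nat.right_le_pair _ _
  have hk2 : k < 2 ^ k := Nat.lt_two_pow_self
  have hpow : 2 ^ (k+1) = 2 * 2 ^ k := by ring
  have hfi : ∀ i, fstar (a i) = lab i := fun i => congrFun hfs i
  rw [hfs]
  simp only [hfi]
  refine ⟨2 ^ (k+1) - n, by omega, by omega, ?_⟩
  have hsub : Finset.Ico (2 ^ k - n) (2 ^ (k+1) - n) ⊆ Finset.range (2 ^ (k+1) - n) := by
    intro s hs
    simp only [Finset.mem_Ico, Finset.mem_range] at *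
    exact hs.2
  refine le_trans ?_ (Finset.sum_le_sum_of_subset_of_nonneg hsub (fun _ _ _ => dist_nonneg))
  have hterm : ∀ s ∈ Finset.Ico (2 ^ k - n) (2 ^ (k+1) - n),
      dist y₁ y₂ / 2 ≤ dist (p n (n + s) lab) (lab (n + s)) := by
    intro s hs
    simp only [Finset.mem_Ico] at hs
    have hlog : Nat.log 2 (n + s) = k := by
      rw [Nat.log_eq_iff (Or.inr ⟨by norm_num, by omega⟩)]
      omega
    have hgn : g (n + s) = n := by simp [g, hlog, k]
    have := hbad (n + s) (by omega)
    rwa [hgn] at this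
  refine le_trans ?_ (Finset.card_nsmul_le_sum _ _ _ hterm)
  rw [Nat.card_Ico, nsmul_eq_mul]
  have h1 : (2 ^ (k+1) - n) - (2 ^ k - n) = 2 ^ k := by omega
  rw [h1]
  have h2 : ((2 ^ (k+1) - n : ℕ) : ℝ) ≤ 2 * (2 ^ k : ℕ) := by
    have : 2 ^ (k+1) - n ≤ 2 * 2 ^ k := by omega
    exact_mod_cast this
  have := mul_le_mul_of_nonneg_left h2 (show 0 ≤ dist y₁ y₂ / 4 by positivity)
  linarith

section fresh
variable {X Y : Type*} [TopologicalSpace X] [T1Space X]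
    [MeasurableSpace X] [BorelSpace X] [MetricSpace Y] [MeasurableSpace Y]

theorem avg_le {C : ℝ} (g : ℕ → ℝ) (hg : ∀ s, g s ≤ C) (hC : 0 ≤ C) (T : ℕ) :
    (∑ s ∈ Finset.range T, g s) / (T : ℝ) ≤ C := by
  have : ∑ s ∈ Finset.range T, g s ≤ T * C := by
    have := Finset.sum_le_card_nsmul (Finset.range T) g C (fun s _ => hg s)
    simpa using this
  rcases Nat.eq_zero_or_pos T with h | h
  · subst h; simpa using hC
  · rw [div_le_iff₀ (by exact_mod_cast h)]; linarith

theorem avg_ge {d : ℝ} (g : ℕ → ℝ) (T : ℕ) (hT : 1 ≤ T)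
    (h : d * T ≤ ∑ s ∈ Finset.range T, g s) : d ≤ (∑ s ∈ Finset.range T, g s) / (T : ℝ) := by
  rw [le_div_iff₀ (by exact_mod_cast hT)]; exact h

theorem not_tendsto_of_ge {u : ℕ → ℝ} {d : ℝ} (hd : 0 < d) (h : ∃ᶠ n in atTop, d ≤ u n) :
    ¬ Tendsto u atTop (𝓝 0) := fun ht =>
  h ((ht.eventually_lt_const hd).mono fun _ hn => not_le.mpr hn)

theorem not_SUIL (hbdd : ∃ C : ℝ, ∀ y₁ y₂ : Y, dist y₁ y₂ ≤ C)
    (hnontriv : ∃ y₁ y₂ : Y, 0 < dist y₁ y₂) (a : ℕ → X) (N : ℕ)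
    (hfresh : ∀ m, N ≤ m → ∀ i < m, a i ≠ a m) : ¬ SUIL Y (Measure.dirac a) := by
  rintro ⟨f, -, hf⟩
  obtain ⟨C, hC⟩ := hbdd
  obtain ⟨y₁, y₂, hd⟩ := hnontriv
  obtain ⟨fs, hfs, hT⟩ := exists_bad_target y₁ y₂ a N hfresh
    (fun n m l => f n (fun i => a i.1) (fun i => l i.1) (a m)) (by
      intro n m l l' hnm h
      have : (fun i : Fin n => l i.1) = fun i => l' i.1 :=
        funext fun i => h i.1 (lt_of_lt_of_le i.2 hnm)
      simp only [this])
  have h := hf fs hfs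
  rw [ae_dirac_eq] at h
  refine not_tendsto_of_ge (d := dist y₁ y₂ / 4) (by positivity) (Frequently.of_forall fun n => ?_) h
  refine le_limsup_of_frequently_le ?_ ?_
  · rw [frequently_atTop]
    intro M
    obtain ⟨T, hMT, h1, hs⟩ := hT n M
    exact ⟨T, hMT, avg_ge _ T h1 hs⟩
  · exact isBoundedUnder_of ⟨C, fun T => avg_le _ (fun s => hC _ _) (hd.le.trans (hC _ _)) T⟩

theorem not_SUAL (hbdd : ∃ C : ℝ, ∀ y₁ y₂ : Y, dist y₁ y₂ ≤ C)
    (hnontriv : ∃ y₁ y₂ : Y, 0 < dist y₁ y₂) (a : ℕ → X) (N : ℕ)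
    (hfresh : ∀ m, N ≤ m → ∀ i < m, a i ≠ a m) : ¬ SUAL Y (Measure.dirac a) := by
  rintro ⟨f, -, hf⟩
  obtain ⟨C, hC⟩ := hbdd
  obtain ⟨y₁, y₂, hd⟩ := hnontriv
  obtain ⟨fs, hfs, hT⟩ := exists_bad_target y₁ y₂ a N hfresh
    (fun n m l => f n m (fun i => a i.1) (fun i => l i.1) (a m)) (by
      intro n m l l' hnm h
      have : (fun i : Fin n => l i.1) = fun i => l' i.1 :=
        funext fun i => h i.1 (lt_of_lt_of_le i.2 hnm)
      simp only [this])
  have h := hf fs hfs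
  rw [ae_dirac_eq] at h
  refine not_tendsto_of_ge (d := dist y₁ y₂ / 4) (by positivity) (Frequently.of_forall fun n => ?_) h
  refine le_limsup_of_frequently_le ?_ ?_
  · rw [frequently_atTop]
    intro M
    obtain ⟨T, hMT, h1, hs⟩ := hT n (M+1)
    obtain ⟨t, rfl⟩ : ∃ t, T = t + 1 := ⟨T - 1, by omega⟩
    refine ⟨t, by omega, ?_⟩
    have := avg_ge _ (t+1) h1 hs
    rwa [Nat.cast_add_one] at this
  · refine isBoundedUnder_of ⟨C, fun T => ?_⟩
    have := avg_le (fun s => dist (f n (n + s) (fun i => a i.1) (fun i => fs (a i.1)) (a (n + s)))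
            (fs (a (n + s)))) (fun s => hC _ _) (hd.le.trans (hC _ _)) (T+1)
    rwa [Nat.cast_add_one] at this

theorem not_SUOL (hnontriv : ∃ y₁ y₂ : Y, 0 < dist y₁ y₂) (a : ℕ → X) (N : ℕ)
    (hfresh : ∀ m, N ≤ m → ∀ i < m, a i ≠ a m) : ¬ SUOL Y (Measure.dirac a) := by
  rintro ⟨f, -, hf⟩
  obtain ⟨y₁, y₂, hd⟩ := hnontriv
  obtain ⟨fs, hfs, hT⟩ := exists_bad_target y₁ y₂ a N hfresh
    (fun n m l => f m (fun i => a i.1) (fun i => l i.1) (a m)) (by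
      intro n m l l' hnm h
      have : (fun i : Fin m => l i.1) = fun i => l' i.1 := funext fun i => h i.1 i.2
      simp only [this])
  have h := hf fs hfs
  rw [ae_dirac_eq] at h
  refine not_tendsto_of_ge (d := dist y₁ y₂ / 4) (by positivity) ?_ h
  rw [frequently_atTop]
  intro M
  obtain ⟨T, hMT, h1, hs⟩ := hT 0 M
  let G : ℕ → ℝ := fun t => dist (f t (fun i => a i.1) (fun i => fs (a i.1)) (a t)) (fs (a t))
  have hs2 : dist y₁ y₂ / 4 * T ≤ ∑ s ∈ Finset.range T, G (0 + s) := hs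
  simp only [Nat.zero_add] at hs2
  exact ⟨T, hMT, avg_ge G T h1 hs2⟩

theorem yes_SUIL [Nonempty Y] (a : ℕ → X) (N : ℕ)
    (hc : ∀ m, N ≤ m → a m = a N) : SUIL Y (Measure.dirac a) := by
  obtain ⟨y0⟩ := ‹Nonempty Y›
  refine ⟨fun n _ ys _ => if h : N < n then ys ⟨N, h⟩ else y0, ?_, ?_⟩
  · intro n
    by_cases h : N < n
    · simp only [h, dite_true]; fun_prop
    · simp only [h, dite_false]; fun_prop
  · intro fs _
    rw [ae_dirac_eq]
    refine tendsto_const_nhds.congr' ?_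
    filter_upwards [eventually_gt_atTop N] with n hn
    have : ∀ s, a (n + s) = a N := fun s => hc _ (by omega)
    simp [indLoss, hn, this]

theorem yes_SUAL [Nonempty Y] (a : ℕ → X) (N : ℕ)
    (hc : ∀ m, N ≤ m → a m = a N) : SUAL Y (Measure.dirac a) := by
  obtain ⟨y0⟩ := ‹Nonempty Y›
  refine ⟨fun n _ _ ys _ => if h : N < n then ys ⟨N, h⟩ else y0, ?_, ?_⟩
  · intro n m _
    by_cases h : N < n
    · simp only [h, dite_true]; fun_prop
    · simp only [h, dite_false]; fun_prop
  · intro fs _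
    rw [ae_dirac_eq]
    refine tendsto_const_nhds.congr' ?_
    filter_upwards [eventually_gt_atTop N] with n hn
    have : ∀ s, a (n + s) = a N := fun s => hc _ (by omega)
    simp [adaLoss, hn, this]

theorem yes_SUOL [Nonempty Y] (a : ℕ → X) (N : ℕ)
    (hc : ∀ m, N ≤ m → a m = a N) : SUOL Y (Measure.dirac a) := by
  obtain ⟨y0⟩ := ‹Nonempty Y›
  refine ⟨fun n _ ys _ => if h : N < n then ys ⟨N, h⟩ else y0, ?_, ?_⟩
  · intro n
    by_cases h : N < n
    · simp only [h, dite_true]; fun_prop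
    · simp only [h, dite_false]; fun_prop
  · intro fs _
    rw [ae_dirac_eq]
    set g : ℕ → ℝ := fun t => dist (if h : N < t then fs (a N) else y0) (fs (a t)) with hg
    have hlim : Tendsto (fun n : ℕ => (∑ t ∈ Finset.range (N+1), g t) / (n : ℝ)) atTop (𝓝 0) :=
      tendsto_const_nhds.div_atTop tendsto_natCast_atTop_atTop
    refine hlim.congr' ?_
    filter_upwards [eventually_gt_atTop N] with n hn
    have : ∑ t ∈ Finset.range (N+1), g t = ∑ t ∈ Finset.range n, g t := by
      refine Finset.sum_subset (Finset.range_mono (by omega)) ?_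
      intro t _ ht
      have ht' : N < t := by simpa using ht
      simp [hg, ht', hc t ht'.le]
    rw [this]
    rfl

theorem test_dirac (t : ∀ n : ℕ, (Fin n → X) → Bool) (ht : ∀ n, Measurable (t n))
    (a : ℕ → X) (P : Measure (ℕ → X) → Prop)
    (hyes : ∀ N, (∀ m, N ≤ m → t m (fun i => a i.1) = false) → P (Measure.dirac a))
    (hno : ∀ N, (∀ m, N ≤ m → t m (fun i => a i.1) = true) → ¬ P (Measure.dirac a)) :
    ¬ TestCorrectAt t P (Measure.dirac a) := by
  rintro ⟨h1, h2⟩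
  have key : ∀ b : Bool,
      Tendsto (fun n => Measure.dirac a {x | t n (fun i => x i.1) = b}) atTop (𝓝 0) →
      ∃ N, ∀ m, N ≤ m → t m (fun i => a i.1) = !b := by
    intro b hb
    have := hb.eventually_lt_const (show (0 : ENNReal) < 1 by norm_num)
    obtain ⟨N, hN⟩ := eventually_atTop.mp this
    refine ⟨N, fun m hm => ?_⟩
    have h := hN m hm
    by_contra hne
    have hmem : a ∈ {x : ℕ → X | t m (fun i => x i.1) = b} := by
      simp only [Set.mem_setOf_eq]
      revert hne
      cases b <;> cases t m (fun i => a i.1) <;> simp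
    rw [Measure.dirac_apply_of_mem hmem] at h
    exact lt_irrefl _ h
  by_cases hP : P (Measure.dirac a)
  · obtain ⟨N, hN⟩ := key false (h1 hP)
    exact hno N hN hP
  · obtain ⟨N, hN⟩ := key true (h2 hP)
    exact hP (hyes N hN)

end fresh

/-- **Theorem 38 (Hanneke).** If `X` is infinite, there is no consistent hypothesis test
for `SUIL`, `SUAL`, or `SUOL`: for every hypothesis test there is a process at which it
fails to behave correctly for each of these three families. -/
theorem no_consistent_test (X Y : Type*) [Infinite X]
    [TopologicalSpace X] [TopologicalSpace.MetrizableSpace X]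
    [TopologicalSpace.SeparableSpace X] [Nonempty X] [MeasurableSpace X] [BorelSpace X]
    [MetricSpace Y] [TopologicalSpace.SeparableSpace Y] [Nonempty Y]
    [MeasurableSpace Y] [BorelSpace Y]
    (hbdd : ∃ C : ℝ, ∀ y₁ y₂ : Y, dist y₁ y₂ ≤ C)
    (hnontriv : ∃ y₁ y₂ : Y, 0 < dist y₁ y₂) :
    ∀ t : ∀ n : ℕ, (Fin n → X) → Bool, (∀ n, Measurable (t n)) →
      ∃ μ : Measure (ℕ → X), IsProbabilityMeasure μ ∧
        ¬ TestCorrectAt t (SUIL Y) μ ∧ ¬ TestCorrectAt t (SUAL Y) μ ∧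
          ¬ TestCorrectAt t (SUOL Y) μ := by
  intro t ht
  classical
  let z : ℕ → X := Infinite.natEmbedding X
  have hz : Function.Injective z := (Infinite.natEmbedding X).injective
  let F : ℕ → (ℕ → X) → X := fun m l => if t m (fun i => l i.1) = true then z (m + 1) else z 0
  let a := seqRec (z 0) F
  have ha : ∀ m, a m = F m a := seqRec_spec (z 0) F (by
    intro m l l' h
    have : (fun i : Fin m => l i.1) = fun i => l' i.1 := funext fun i => h i.1 i.2
    simp only [F, this])
  have hfalse : ∀ m, t m (fun i => a i.1) = false → a m = z 0 := by
    intro m h; rw [ha]; simp [F, h]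
  have htrue : ∀ m, t m (fun i => a i.1) = true → a m = z (m + 1) := by
    intro m h; rw [ha]; simp [F, h]
  have hconst : ∀ N, (∀ m, N ≤ m → t m (fun i => a i.1) = false) → ∀ m, N ≤ m → a m = a N := by
    intro N h m hm
    rw [hfalse m (h m hm), hfalse N (h N le_rfl)]
  have hfresh : ∀ N, (∀ m, N ≤ m → t m (fun i => a i.1) = true) →
      ∀ m, N ≤ m → ∀ i < m, a i ≠ a m := by
    intro N h m hm i hi
    rw [htrue m (h m hm)]
    cases hti : t i (fun i => a i.1)
    · rw [hfalse i hti]; intro he; have := hz he; omega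
    · rw [htrue i hti]; intro he; have := hz he; omega
  refine ⟨Measure.dirac a, inferInstance, ?_, ?_, ?_⟩
  · exact test_dirac t ht a _ (fun N h => yes_SUIL a N (hconst N h))
      (fun N h => not_SUIL hbdd hnontriv a N (hfresh N h))
  · exact test_dirac t ht a _ (fun N h => yes_SUAL a N (hconst N h))
      (fun N h => not_SUAL hbdd hnontriv a N (hfresh N h))
  · exact test_dirac t ht a _ (fun N h => yes_SUOL a N (hconst N h))
      (fun N h => not_SUOL hnontriv a N (hfresh N h))
end

section
/- A process 𝕏 satisfies Condition 3 if and only if every measurable function f : X → ℝ satisfies sup_{t ∈ ℕ} f(X_t) < ∞ almost surely. -/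
open MeasureTheory Filter Topology

/-- Condition 3: for every monotone sequence `{A_k}` of measurable sets with `A_k ↓ ∅`,
almost surely only finitely many of the `A_k` are visited by the process. -/
def Condition3 {X : Type*} [MeasurableSpace X] (μ : Measure (ℕ → X)) : Prop :=
  ∀ A : ℕ → Set X, (∀ k, MeasurableSet (A k)) → Antitone A → (⋂ k, A k) = ∅ →
    ∀ᵐ x ∂μ, {k : ℕ | ∃ t : ℕ, x t ∈ A k}.Finite

/-- **Lemma 45 (Hanneke).** A process satisfies Condition 3 iff every measurable function
`f : X → ℝ` satisfies `sup_t f(X_t) < ∞` almost surely. -/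
theorem condition3_iff_bddAbove (X : Type*)
    [TopologicalSpace X] [TopologicalSpace.MetrizableSpace X]
    [TopologicalSpace.SeparableSpace X] [Nonempty X] [MeasurableSpace X] [BorelSpace X]
    (μ : Measure (ℕ → X)) (hμ : IsProbabilityMeasure μ) :
    Condition3 μ ↔
      ∀ f : X → ℝ, Measurable f →
        ∀ᵐ x ∂μ, BddAbove (Set.range fun t : ℕ => f (x t)) := by
  classical
  constructor
  · intro h f hf
    have := h (fun k => {y | (k : ℝ) ≤ f y}) (fun k => measurableSet_le measurable_const hf)
      (fun a b hab y hy => by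
        have h1 : (a : ℝ) ≤ b := by exact_mod_cast hab
        exact h1.trans hy)
      (by
        ext y
        simp only [Set.mem_iInter, Set.mem_setOf_eq, Set.mem_empty_iff_false, iff_false, not_forall,
          not_le]
        exact exists_nat_gt (f y))
    filter_upwards [this] with x hx
    obtain ⟨k, hk⟩ := hx.exists_notMem
    refine ⟨k, ?_⟩
    rintro _ ⟨t, rfl⟩
    by_contra hc
    exact hk ⟨t, (not_le.mp hc).le⟩
  · intro h A hA hanti hempty
    have hex : ∀ y, ∃ k, y ∉ A k := by
      intro y
      by_contra! hc
      have : y ∈ ⋂ k, A k := Set.mem_iInter.2 hc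
      simp [hempty] at this
    have hm : Measurable fun y => ((Nat.find (hex y) : ℕ) : ℝ) :=
      measurable_from_top.comp (measurable_find hex fun k => (hA k).compl)
    filter_upwards [h _ hm] with x hx
    obtain ⟨C, hC⟩ := hx
    obtain ⟨N, hN⟩ := exists_nat_ge C
    refine (Set.finite_Iio N).subset ?_
    rintro k ⟨t, ht⟩
    have h1 : ((Nat.find (hex (x t)) : ℕ) : ℝ) ≤ N := (hC ⟨t, rfl⟩).trans hN
    have h2 : Nat.find (hex (x t)) ≤ N := by exact_mod_cast h1
    by_contra hk
    have h3 : N ≤ k := not_lt.mp hk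
    exact Nat.find_spec (hex (x t)) (hanti (h2.trans h3) ht)
end
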